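/- arXiv:math/0210079 — 3 statements merged into one kernel-verified Lean document; each statement's English description precedes it below -/
import Mathlib

section
/- Let M be a finitely generated graded module over S = k[x_1,…,x_n] with minimal graded free resolution with free modules F_i and let b_i be the maximum degree of the generators of F_i. Then for every t with 0 ≤ t ≤ n, max{m : Ext_S^i(M,S)_{−m−n} ≠ 0 for some i ≥ n−t} = max{b_i : i ≥ n−t} − n. -/
set_option synthInstance.maxHeartbeats 1000000
set_option maxHeartbeats 1000000

/-! Common definitions: gradings, term orders, initial ideals, generic initial ideals,
Borel-fixed ideals, filter-regular sequences, a Koszul/Čech-type description of graded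
local cohomology and the invariants `a_i`, `reg_t`, `a*_t`, minimal graded free
resolutions, and reductions. -/

namespace Paper

open MvPolynomial

noncomputable section

variable {k : Type*} [Field k] {n : ℕ}

/-- Total degree of an exponent vector. -/
def adeg (a : Fin n →₀ ℕ) : ℕ := ∑ j, a j

/-- `m(x^A)` : the largest (1-based) index `i` such that `xᵢ` divides `x^A`. -/
def mval (a : Fin n →₀ ℕ) : ℕ := a.support.sup fun j => (j : ℕ) + 1

/-- The degree-`d` homogeneous piece of the polynomial ring (`⊥` in negative degrees). -/
def sPiece (k : Type*) [Field k] (n : ℕ) (d : ℤ) : Submodule k (MvPolynomial (Fin n) k) :=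
  if 0 ≤ d then homogeneousSubmodule (Fin n) k d.toNat else ⊥

/-- `I` is a homogeneous (graded) ideal. -/
def IsHomog (I : Ideal (MvPolynomial (Fin n) k)) : Prop :=
  ∀ f ∈ I, ∀ d : ℕ, homogeneousComponent d f ∈ I

/-- Degree reverse lexicographic order with `x₁ > x₂ > ⋯ > xₙ` : `a < b`. -/
def drlt (a b : Fin n →₀ ℕ) : Prop :=
  adeg a < adeg b ∨
    (adeg a = adeg b ∧ ∃ i : Fin n, b i < a i ∧ ∀ j : Fin n, i < j → a j = b j)

/-- Lexicographic order with `x₁ > x₂ > ⋯ > xₙ` : `a < b`. -/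
def lexlt (a b : Fin n →₀ ℕ) : Prop :=
  ∃ i : Fin n, a i < b i ∧ ∀ j : Fin n, j < i → a j = b j

/-- An abstract term order on monomials in `n` variables. -/
structure TermOrder (n : ℕ) where
  lt : (Fin n →₀ ℕ) → (Fin n →₀ ℕ) → Prop
  irrefl : ∀ a, ¬ lt a a
  trans : ∀ a b c, lt a b → lt b c → lt a c
  total : ∀ a b, a ≠ b → lt a b ∨ lt b a
  add_right : ∀ a b c, lt a b → lt (a + c) (b + c)
  zero_bot : ∀ a, a ≠ 0 → lt 0 a

/-- `a` is the leading exponent of `f` with respect to the term order `lt`. -/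
def IsLeadExp (lt : (Fin n →₀ ℕ) → (Fin n →₀ ℕ) → Prop)
    (f : MvPolynomial (Fin n) k) (a : Fin n →₀ ℕ) : Prop :=
  a ∈ f.support ∧ ∀ b ∈ f.support, b ≠ a → lt b a

/-- The initial ideal of `I` with respect to the term order `lt`. -/
def inIdealW (lt : (Fin n →₀ ℕ) → (Fin n →₀ ℕ) → Prop)
    (I : Ideal (MvPolynomial (Fin n) k)) : Ideal (MvPolynomial (Fin n) k) :=
  Ideal.span {m | ∃ f a, f ∈ I ∧ IsLeadExp lt f a ∧ m = monomial a (1 : k)}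

/-- The initial ideal with respect to the (degree) reverse lexicographic order. -/
def inIdeal (I : Ideal (MvPolynomial (Fin n) k)) : Ideal (MvPolynomial (Fin n) k) :=
  inIdealW drlt I

/-- The linear change of coordinates associated to a matrix `g`, `xⱼ ↦ ∑ᵢ gᵢⱼ xᵢ`. -/
def act (g : Matrix (Fin n) (Fin n) k) :
    MvPolynomial (Fin n) k →ₐ[k] MvPolynomial (Fin n) k :=
  aeval fun j => ∑ i, C (g i j) * X i

/-- The image of the ideal `I` under the linear change of coordinates `g`. -/
def actI (g : Matrix (Fin n) (Fin n) k) (I : Ideal (MvPolynomial (Fin n) k)) :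
    Ideal (MvPolynomial (Fin n) k) :=
  Ideal.map (act g) I

/-- `J` is the generic initial ideal of `I` w.r.t. the term order `lt`:
there is a nonempty Zariski-open subset `U ⊆ GL(n,k)` with `in(g I) = J` for all `g ∈ U`. -/
def IsGinW (lt : (Fin n →₀ ℕ) → (Fin n →₀ ℕ) → Prop)
    (I J : Ideal (MvPolynomial (Fin n) k)) : Prop :=
  ∃ U : Set (Matrix (Fin n) (Fin n) k), U.Nonempty ∧
    (∃ P : Set (MvPolynomial (Fin n × Fin n) k),
      U = {g | IsUnit g.det ∧ ∃ p ∈ P, MvPolynomial.eval (fun q => g q.1 q.2) p ≠ 0}) ∧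
    ∀ g ∈ U, inIdealW lt (actI g I) = J

/-- Generic initial ideal with respect to the reverse lexicographic order. -/
def IsGin (I J : Ideal (MvPolynomial (Fin n) k)) : Prop := IsGinW drlt I J

/-- `I` is a monomial ideal. -/
def IsMonomialIdeal (I : Ideal (MvPolynomial (Fin n) k)) : Prop :=
  ∃ A : Set (Fin n →₀ ℕ), I = Ideal.span ((fun a => (monomial a (1 : k))) '' A)

/-- The maximal graded ideal `𝔐 = (x₁, …, xₙ)` of the polynomial ring. -/
def maxIdeal (k : Type*) [Field k] (n : ℕ) : Ideal (MvPolynomial (Fin n) k) :=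
  Ideal.span (Set.range X)

/-- `x^a` is a minimal (monomial) generator of the monomial ideal `I`. -/
def IsMinGen (I : Ideal (MvPolynomial (Fin n) k)) (a : Fin n →₀ ℕ) : Prop :=
  monomial a (1 : k) ∈ I ∧ monomial a (1 : k) ∉ maxIdeal k n * I

def IsUpperTriangular (g : Matrix (Fin n) (Fin n) k) : Prop :=
  ∀ i j : Fin n, j < i → g i j = 0

/-- `I` is Borel-fixed: fixed by every invertible upper triangular change of coordinates. -/
def IsBorelFixed (I : Ideal (MvPolynomial (Fin n) k)) : Prop :=
  ∀ g : Matrix (Fin n) (Fin n) k, IsUnit g.det → IsUpperTriangular g → actI g I = I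

/-- Degree-`d` piece of the standard grading on `S/I` (for `I` homogeneous). -/
def qPiece (I : Ideal (MvPolynomial (Fin n) k)) (d : ℤ) :
    Submodule k (MvPolynomial (Fin n) k ⧸ I) :=
  (sPiece k n d).map (Ideal.Quotient.mkₐ k I).toLinearMap

/-- Degree-`d` piece of the standard grading on the ideal `I` viewed as a module. -/
def iPiece (I : Ideal (MvPolynomial (Fin n) k)) (d : ℤ) : Submodule k ↥I :=
  (sPiece k n d).comap ((I.subtype).restrictScalars k)

/-- The maximal graded ideal of `S/I`. -/
def maxIdealQ (I : Ideal (MvPolynomial (Fin n) k)) : Ideal (MvPolynomial (Fin n) k ⧸ I) :=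
  (maxIdeal k n).map (Ideal.Quotient.mk I)

/-- `z 0, …, z (s-1)` is a filter-regular sequence in `R` (with maximal graded ideal `mR`):
`z i` avoids all associated primes `≠ mR` of `(z 0, …, z (i-1))`. -/
def FilterRegular {R : Type*} [CommRing R] (mR : Ideal R) (z : ℕ → R) (s : ℕ) : Prop :=
  ∀ i < s, ∀ p ∈ associatedPrimes R (R ⧸ Ideal.span {x | ∃ j < i, x = z j}),
    p ≠ mR → z i ∉ p

/-- The sequence `xₙ, xₙ₋₁, …, x₁` in `S/I` (extended by `0`). -/
def revVars (I : Ideal (MvPolynomial (Fin n) k)) (j : ℕ) :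
    MvPolynomial (Fin n) k ⧸ I :=
  if h : j < n then Ideal.Quotient.mk I (X ⟨n - 1 - j, by omega⟩) else 0

section LC

variable {M : Type*} [AddCommGroup M]

/-- `i`-cochains of the stable Koszul (Čech) complex on the variables. -/
abbrev Koch (n : ℕ) (M : Type*) (i : ℕ) : Type _ :=
  {T : Finset (Fin n) // T.card = i} → M

/-- The differential (into cohomological degree `i`) of the Koszul complex
on `x₁ᵗ, …, xₙᵗ` with coefficients in `M`. -/
def kdelta [Module (MvPolynomial (Fin n) k) M] (t i : ℕ)
    (v : Koch n M (i - 1)) : Koch n M i := fun T =>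
  ∑ j ∈ T.1.attach,
    ((-1 : ℤ) ^ ((T.1.filter (fun l => l < j.1)).card)) •
      ((X j.1 ^ t : MvPolynomial (Fin n) k) •
        v ⟨T.1.erase j.1, by rw [Finset.card_erase_of_mem j.2, T.2]⟩)

/-- The transition map from the Koszul complex at level `t` to the one at level `t+1`. -/
def ktrans [Module (MvPolynomial (Fin n) k) M] (i : ℕ) (v : Koch n M i) : Koch n M i :=
  fun T => ((∏ j ∈ T.1, X j : MvPolynomial (Fin n) k)) • v T

/-- The cochain `v` lies in the degree-`d` strand (for the grading `ℳ` of `M`,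
where the Koszul generators at level `t` have degree `t`). -/
def strand [Module k M] (ℳ : ℤ → Submodule k M) (t i : ℕ) (d : ℤ)
    (v : Koch n M i) : Prop :=
  ∀ T, v T ∈ ℳ (d + (t : ℤ) * (i : ℤ))

/-- `H^i_𝔐(M)_d ≠ 0` : the degree-`d` strand of `i`-th local cohomology (computed as the
direct limit over `t` of the Koszul cohomology on `x₁ᵗ, …, xₙᵗ`) is nonzero. -/
def lcNonvanish (n : ℕ) [Module k M] [Module (MvPolynomial (Fin n) k) M]
    (ℳ : ℤ → Submodule k M) (i : ℕ) (d : ℤ) : Prop :=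
  ∃ (t : ℕ) (v : Koch n M i),
    strand ℳ t i d v ∧ kdelta (k := k) t (i + 1) v = 0 ∧
    ∀ s : ℕ, ¬ ∃ w : Koch n M (i - 1),
      strand ℳ (t + s) (i - 1) d w ∧
        kdelta (k := k) (t + s) i w = (ktrans (k := k) i)^[s] v

open Classical in
/-- `a_i(M)` : the largest degree `d` with `H^i_𝔐(M)_d ≠ 0` (`⊥` if `H^i_𝔐(M) = 0`). -/
def aDeg (n : ℕ) [Module k M] [Module (MvPolynomial (Fin n) k) M]
    (ℳ : ℤ → Submodule k M) (i : ℕ) : WithBot ℤ :=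
  if (∃ d : ℤ, lcNonvanish n ℳ i d) then
    ((sSup {d : ℤ | lcNonvanish n ℳ i d} : ℤ) : WithBot ℤ)
  else ⊥

/-- `reg_t(M) = max{a_i(M) + i : i ≤ t}`. -/
def regT (n : ℕ) [Module k M] [Module (MvPolynomial (Fin n) k) M]
    (ℳ : ℤ → Submodule k M) (t : ℕ) : WithBot ℤ :=
  (Finset.range (t + 1)).sup fun i => aDeg n ℳ i + ((i : ℤ) : WithBot ℤ)

/-- `a*_t(M) = max{a_i(M) : i ≤ t}`. -/
def aStarT (n : ℕ) [Module k M] [Module (MvPolynomial (Fin n) k) M]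
    (ℳ : ℤ → Submodule k M) (t : ℕ) : WithBot ℤ :=
  (Finset.range (t + 1)).sup fun i => aDeg n ℳ i

end LC

open Classical in
/-- Supremum of a set of integers, as an element of `WithBot ℤ` (`⊥` for the empty set). -/
def zSupBot (A : Set ℤ) : WithBot ℤ :=
  if A.Nonempty then ((sSup A : ℤ) : WithBot ℤ) else ⊥

section Res

variable (k) (n)
variable (M : Type*) [AddCommGroup M] [Module k M]
  [Module (MvPolynomial (Fin n) k) M]

/-- A minimal graded free resolution `0 → F_len → ⋯ → F_1 → F_0 → M` of the graded
module `M` (with grading `ℳ`): `F i` is free with basis elements of degrees `tw i j`,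
the maps are degree-preserving, the complex is exact, and all differentials map into
`𝔐 ⬝ F i` (minimality). -/
structure MGFR (ℳ : ℤ → Submodule k M) where
  len : ℕ
  rk : ℕ → ℕ
  tw : (i : ℕ) → Fin (rk i) → ℤ
  rk_top : ∀ i, len < i → rk i = 0
  aug : (Fin (rk 0) → MvPolynomial (Fin n) k) →ₗ[MvPolynomial (Fin n) k] M
  diff : (i : ℕ) → ((Fin (rk (i + 1)) → MvPolynomial (Fin n) k)
      →ₗ[MvPolynomial (Fin n) k] (Fin (rk i) → MvPolynomial (Fin n) k))
  aug_surj : Function.Surjective aug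
  exact_zero : LinearMap.ker aug = LinearMap.range (diff 0)
  exact_succ : ∀ i, LinearMap.ker (diff i) = LinearMap.range (diff (i + 1))
  graded_aug : ∀ (d : ℤ) (v : Fin (rk 0) → MvPolynomial (Fin n) k),
    (∀ j, v j ∈ sPiece k n (d - tw 0 j)) → aug v ∈ ℳ d
  graded_diff : ∀ (i : ℕ) (d : ℤ) (v : Fin (rk (i + 1)) → MvPolynomial (Fin n) k),
    (∀ j, v j ∈ sPiece k n (d - tw (i + 1) j)) → ∀ j, diff i v j ∈ sPiece k n (d - tw i j)
  minimal : ∀ i, LinearMap.range (diff i) ≤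
    (maxIdeal k n) • (⊤ : Submodule (MvPolynomial (Fin n) k)
      (Fin (rk i) → MvPolynomial (Fin n) k))

variable {k n M} {ℳ : ℤ → Submodule k M}

/-- `b_i` : the maximum degree of the generators of `F_i` (`⊥` if `F_i = 0`). -/
def bdeg (res : MGFR k n M ℳ) (i : ℕ) : WithBot ℤ :=
  Finset.univ.sup fun j : Fin (res.rk i) => ((res.tw i j : ℤ) : WithBot ℤ)

/-- The `j`-th syzygy module of `M`, as a submodule of `F_j`. -/
def syzSub (res : MGFR k n M ℳ) : (j : ℕ) →
    Submodule (MvPolynomial (Fin n) k) (Fin (res.rk j) → MvPolynomial (Fin n) k)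
  | 0 => LinearMap.ker res.aug
  | (m + 1) => LinearMap.ker (res.diff m)

/-- The degree-`d` piece of the induced grading on the `j`-th syzygy module. -/
def syzPiece (res : MGFR k n M ℳ) (j : ℕ) (d : ℤ) :
    Submodule k ↥(syzSub res j) :=
  Submodule.comap ((syzSub res j).subtype.restrictScalars k)
    (Submodule.pi Set.univ fun l => sPiece k n (d - res.tw j l))

/-- The dual (transposed) differential, into cohomological degree `i`,
of the complex `Hom(F_•, S)` computing `Ext^•(M, S)`. -/
def extDiffInto (res : MGFR k n M ℳ) : (i : ℕ) →
    (Fin (res.rk (i - 1)) → MvPolynomial (Fin n) k) →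
      (Fin (res.rk i) → MvPolynomial (Fin n) k)
  | 0 => fun _ => 0
  | (m + 1) => fun u j' => ∑ j, res.diff m (Pi.single j' 1) j * u j

/-- `Ext^i_S(M, S)_r ≠ 0`, computed from the given minimal graded free resolution;
the dual basis element of a generator of degree `tw i j` has degree `-tw i j`. -/
def ExtNonzero (res : MGFR k n M ℳ) (i : ℕ) (r : ℤ) : Prop :=
  ∃ u : Fin (res.rk i) → MvPolynomial (Fin n) k,
    (∀ j, u j ∈ sPiece k n (r + res.tw i j)) ∧
    extDiffInto res (i + 1) u = 0 ∧
    ¬ ∃ w : Fin (res.rk (i - 1)) → MvPolynomial (Fin n) k, extDiffInto res i w = u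

end Res

section Red

variable {R : Type*} [CommRing R]

/-- `a` is a reduction of the ideal `mR` : `mR^(r+1) = a * mR^r` for all large `r`. -/
def IsReduction (mR a : Ideal R) : Prop :=
  a ≤ mR ∧ ∃ N, ∀ r ≥ N, mR ^ (r + 1) = a * mR ^ r

/-- `a` is a minimal reduction of `mR`. -/
def IsMinimalReduction (mR a : Ideal R) : Prop :=
  IsReduction mR a ∧ ∀ b, IsReduction mR b → b ≤ a → b = a

/-- The reduction number `r_a` : the least `r` with `mR^(r+1) = a * mR^r`. -/
def redNum (mR a : Ideal R) : ℕ := sInf {r | mR ^ (r + 1) = a * mR ^ r}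

/-- The reduction number: the minimum of `r_a` over all minimal reductions `a` of `mR`. -/
def ringRedNum (mR : Ideal R) : ℕ :=
  sInf {r | ∃ a, IsMinimalReduction mR a ∧ redNum mR a = r}

end Red


theorem ext_upper {M : Type*} [AddCommGroup M] [Module k M]
    [Module (MvPolynomial (Fin n) k) M] {ℳ : ℤ → Submodule k M}
    (res : MGFR k n M ℳ) (i : ℕ) (r : ℤ) (h : ExtNonzero res i r) :
    ∃ j, -r ≤ res.tw i j := by
  obtain ⟨u, hu, -, hne⟩ := h
  by_contra hcon
  push Not at hcon
  apply hne
  refine ⟨0, ?_⟩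
  have hu0 : u = 0 := by
    funext j
    have h1 := hu j
    have h2 := hcon j
    rw [sPiece, if_neg (by omega)] at h1
    simpa using h1
  rw [hu0]
  cases i with
  | zero => rfl
  | succ m => funext j; simp [extDiffInto]

theorem diff_coeff {M : Type*} [AddCommGroup M] [Module k M]
    [Module (MvPolynomial (Fin n) k) M] {ℳ : ℤ → Submodule k M}
    (res : MGFR k n M ℳ) (i : ℕ) (v) (j) :
    constantCoeff (res.diff i v j) = 0 := by
  have h1 := res.minimal i ⟨v, rfl⟩
  have h2 : maxIdeal k n ≤ RingHom.ker (constantCoeff (σ := Fin n) (R := k)) := by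
    rw [maxIdeal, Ideal.span_le]
    rintro _ ⟨l, rfl⟩
    simp [RingHom.mem_ker]
  generalize res.diff i v = w at h1
  induction h1 using Submodule.smul_induction_on' with
  | smul a ha x hx =>
    have := h2 ha
    rw [RingHom.mem_ker] at this
    simp [this]
  | add x hx y hy h3 h4 => simp [h3, h4]

theorem ext_lower {M : Type*} [AddCommGroup M] [Module k M]
    [Module (MvPolynomial (Fin n) k) M] {ℳ : ℤ → Submodule k M}
    (res : MGFR k n M ℳ) (i : ℕ) (j : Fin (res.rk i))
    (h : ∀ j', res.tw (i + 1) j' < res.tw i j) : ExtNonzero res i (-res.tw i j) := by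
  classical
  refine ⟨Pi.single j 1, ?_, ?_, ?_⟩
  · intro l
    by_cases hl : l = j
    · subst hl
      simpa [sPiece] using (⟨1, map_one C⟩ : ∃ y : k, (C y : MvPolynomial (Fin n) k) = 1)
    · rw [Pi.single_eq_of_ne hl]
      exact Submodule.zero_mem _
  · funext j'
    have h1 := res.graded_diff i (res.tw (i + 1) j') (Pi.single j' 1) (by
      intro l
      by_cases hl : l = j'
      · subst hl
        simpa [sPiece] using (⟨1, map_one C⟩ : ∃ y : k, (C y : MvPolynomial (Fin n) k) = 1)
      · rw [Pi.single_eq_of_ne hl]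
        exact Submodule.zero_mem _) j
    have h2 := h j'
    rw [sPiece, if_neg (by omega), Submodule.mem_bot] at h1
    simp only [extDiffInto, Pi.zero_apply]
    apply Finset.sum_eq_zero
    intro l _
    by_cases hl : l = j
    · subst hl
      rw [h1, zero_mul]
    · rw [Pi.single_eq_of_ne hl, mul_zero]
  · rintro ⟨w, hw⟩
    have h1 := congrArg constantCoeff (congrFun hw j)
    rw [Pi.single_eq_same, map_one] at h1
    cases i with
    | zero => simp [extDiffInto] at h1
    | succ m =>
      simp [extDiffInto, diff_coeff] at h1

/-- (Graded local duality computation, used for Theorem 3.1(ii)): for a finitely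
generated graded module `M` with minimal graded free resolution with maximal generator
degrees `b_i`, for `0 ≤ t ≤ n`:
`max{m : Ext^i_S(M,S)_{-m-n} ≠ 0 for some i ≥ n - t} = max{b_i : i ≥ n - t} - n`. -/
theorem statement11 {k : Type*} [Field k] {n : ℕ}
    {M : Type*} [AddCommGroup M] [Module k M]
    [Module (MvPolynomial (Fin n) k) M] [IsScalarTower k (MvPolynomial (Fin n) k) M]
    [Module.Finite (MvPolynomial (Fin n) k) M]
    (ℳ : ℤ → Submodule k M) (hdec : DirectSum.IsInternal ℳ)
    (hcomp : ∀ (a : ℕ) (e : ℤ) (f : MvPolynomial (Fin n) k) (m : M),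
      f ∈ homogeneousSubmodule (Fin n) k a → m ∈ ℳ e → f • m ∈ ℳ ((a : ℤ) + e))
    (res : MGFR k n M ℳ) (t : ℕ) (ht : t ≤ n) :
    zSupBot {m : ℤ | ∃ i : ℕ, n - t ≤ i ∧ ExtNonzero res i (-m - (n : ℤ))} =
      (Finset.Icc (n - t) res.len).sup (fun i => bdeg res i) + ((-(n : ℤ) : ℤ) : WithBot ℤ) := by
  classical
  set T := (Finset.Icc (n - t) res.len).sigma
    (fun i => (Finset.univ : Finset (Fin (res.rk i)))) with hT
  have hmem : ∀ (i : ℕ) (j : Fin (res.rk i)), n - t ≤ i → (⟨i, j⟩ : Σ i, Fin (res.rk i)) ∈ T := by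
    intro i j hi
    simp only [hT, Finset.mem_sigma, Finset.mem_Icc, Finset.mem_univ, and_true]
    refine ⟨hi, ?_⟩
    by_contra hc
    have h0 := res.rk_top i (by omega)
    have := j.2
    omega
  have hge : ∀ p ∈ T, n - t ≤ p.1 := by
    intro p hp
    simp only [hT, Finset.mem_sigma, Finset.mem_Icc] at hp
    exact hp.1.1
  have hsup : (Finset.Icc (n - t) res.len).sup (fun i => bdeg res i) =
      T.sup (fun p => ((res.tw p.1 p.2 : ℤ) : WithBot ℤ)) := by
    rw [hT, Finset.sup_sigma]
    rfl
  rw [hsup]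
  rcases T.eq_empty_or_nonempty with hE | hne
  · rw [hE, Finset.sup_empty, WithBot.bot_add, zSupBot, if_neg]
    rintro ⟨m, i, hi, hx⟩
    obtain ⟨j, -⟩ := ext_upper res i _ hx
    have := hmem i j hi
    rw [hE] at this
    simp at this
  · obtain ⟨p, hp, hpmax⟩ := T.exists_max_image (fun p => res.tw p.1 p.2) hne
    obtain ⟨q, hq, hqmax⟩ := (T.filter (fun q : (Σ i, Fin (res.rk i)) => res.tw q.1 q.2 = res.tw p.1 p.2)).exists_max_image
      (fun p : (Σ i, Fin (res.rk i)) => p.1) ⟨p, by simp [hp]⟩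
    rw [Finset.mem_filter] at hq
    obtain ⟨hqT, hqp⟩ := hq
    have hs : T.sup (fun p => ((res.tw p.1 p.2 : ℤ) : WithBot ℤ)) = (res.tw q.1 q.2 : ℤ) := by
      apply le_antisymm
      · apply Finset.sup_le
        intro x hx
        rw [hqp]
        exact WithBot.coe_le_coe.mpr (hpmax x hx)
      · exact Finset.le_sup (f := fun p : (Σ i, Fin (res.rk i)) =>
          ((res.tw p.1 p.2 : ℤ) : WithBot ℤ)) hqT
    have hg : IsGreatest {m : ℤ | ∃ i : ℕ, n - t ≤ i ∧ ExtNonzero res i (-m - (n : ℤ))}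
        (res.tw q.1 q.2 + -(n : ℤ)) := by
      constructor
      · refine ⟨q.1, hge q hqT, ?_⟩
        have := ext_lower res q.1 q.2 (by
          intro j'
          have hm := hmem (q.1 + 1) j' (by have := hge q hqT; omega)
          have h1 := hpmax _ hm
          rw [← hqp] at h1
          refine lt_of_le_of_ne h1 ?_
          intro h2
          have h3 := hqmax ⟨q.1 + 1, j'⟩ (Finset.mem_filter.mpr ⟨hm, by rw [← hqp]; exact h2⟩)
          simp at h3)
        convert this using 1
        ring
      · rintro m ⟨i, hi, hx⟩
        obtain ⟨j, hj⟩ := ext_upper res i _ hx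
        have := hpmax _ (hmem i j hi)
        simp only at this
        omega
    rw [hs, zSupBot, if_pos ⟨_, hg.1⟩, hg.csSup_eq, ← WithBot.coe_add]
end
end Paper
end

section
/- Let I be a homogeneous ideal of S = k[x_1,…,x_n], let d = dim S/I, and let in(I) be the initial ideal of I with respect to the reverse lexicographic order. If 𝔞 = (I, x_n,…,x_{n−d+1})/I is a minimal reduction of the maximal graded ideal 𝔪 of S/I, then 𝔟 = (in(I), x_n,…,x_{n−d+1})/in(I) is a minimal reduction of the maximal graded ideal of S/in(I), and r_𝔞(S/I) = r_𝔟(S/in(I)). -/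
set_option synthInstance.maxHeartbeats 1000000
set_option maxHeartbeats 1000000

/-! Common definitions: gradings, term orders, initial ideals, generic initial ideals,
Borel-fixed ideals, filter-regular sequences, a Koszul/Čech-type description of graded
local cohomology and the invariants `a_i`, `reg_t`, `a*_t`, minimal graded free
resolutions, and reductions. -/

namespace Paper

open MvPolynomial

noncomputable section

variable {k : Type*} [Field k] {n : ℕ}

section Helpers

lemma adeg_eq (a : Fin n →₀ ℕ) : adeg a = a.degree := by
  simp [adeg, Finsupp.degree_eq_sum]

lemma drlt_irrefl (a : Fin n →₀ ℕ) : ¬ drlt a a := by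
  rintro (h | ⟨-, i, hi, -⟩) <;> omega

lemma drlt_trans (a b c : Fin n →₀ ℕ) (h1 : drlt a b) (h2 : drlt b c) : drlt a c := by
  rcases h1 with h1 | ⟨h1, i, hi, hi'⟩ <;> rcases h2 with h2 | ⟨h2, j, hj, hj'⟩
  · left; omega
  · left; omega
  · left; omega
  · right
    refine ⟨h1.trans h2, ?_⟩
    rcases lt_trichotomy i j with h | h | h
    · refine ⟨j, by rw [hi' j h]; exact hj, fun l hl => ?_⟩
      rw [hi' l (h.trans hl), hj' l hl]
    · subst h
      exact ⟨i, hj.trans hi, fun l hl => by rw [hi' l hl, hj' l hl]⟩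
    · refine ⟨i, by rw [← hj' i h]; exact hi, fun l hl => ?_⟩
      rw [hi' l hl, hj' l (h.trans hl)]

lemma drlt_add (a b c : Fin n →₀ ℕ) (h : drlt a b) : drlt (a + c) (b + c) := by
  have e : ∀ a : Fin n →₀ ℕ, adeg (a + c) = adeg a + adeg c := by
    intro a; simp [adeg, Finset.sum_add_distrib]
  rcases h with h | ⟨h, i, hi, hi'⟩
  · left; rw [e, e]; omega
  · right
    refine ⟨by rw [e, e, h], i, by simpa using hi, fun j hj => by simp [hi' j hj]⟩

/-- exponents of lead monomials -/
def leadSet (I : Ideal (MvPolynomial (Fin n) k)) : Set (Fin n →₀ ℕ) :=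
  {a | ∃ f ∈ I, IsLeadExp drlt f a}

lemma inIdeal_eq (I : Ideal (MvPolynomial (Fin n) k)) :
    inIdeal I = Ideal.span ((fun a => monomial a (1 : k)) '' leadSet I) := by
  unfold inIdeal inIdealW leadSet
  congr 1
  ext m
  simp only [Set.mem_ofPred_eq, Set.mem_image]
  constructor
  · rintro ⟨f, a, hf, ha, rfl⟩; exact ⟨a, ⟨f, hf, ha⟩, rfl⟩
  · rintro ⟨a, ⟨f, hf, ha⟩, rfl⟩; exact ⟨f, a, hf, ha, rfl⟩

lemma leadSet_add (I : Ideal (MvPolynomial (Fin n) k)) {a : Fin n →₀ ℕ} (c : Fin n →₀ ℕ)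
    (h : a ∈ leadSet I) : a + c ∈ leadSet I := by
  obtain ⟨f, hf, ha, hb⟩ := h
  refine ⟨f * monomial c 1, I.mul_mem_right _ hf, ?_, ?_⟩
  · simpa [mem_support_iff, coeff_mul_monomial] using ha
  · intro b hbs hne
    rw [mem_support_iff, coeff_mul_monomial'] at hbs
    split_ifs at hbs with hc
    · obtain ⟨b', rfl⟩ := le_iff_exists_add'.1 hc
      simp only [add_tsub_cancel_right, mul_one] at hbs
      exact drlt_add _ _ _ (hb b' (by rwa [mem_support_iff]) (fun e => hne (by rw [e])))
    · exact absurd rfl hbs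

lemma mem_inIdeal (I : Ideal (MvPolynomial (Fin n) k)) (p : MvPolynomial (Fin n) k) :
    p ∈ inIdeal I ↔ ∀ a ∈ p.support, a ∈ leadSet I := by
  rw [inIdeal_eq, mem_ideal_span_monomial_image]
  refine forall₂_congr fun a _ => ⟨?_, fun h => ⟨a, h, le_rfl⟩⟩
  rintro ⟨b, hb, hba⟩
  obtain ⟨c, rfl⟩ := le_iff_exists_add.1 hba
  exact leadSet_add I c hb

lemma monomial_mem_inIdeal (I : Ideal (MvPolynomial (Fin n) k)) (a : Fin n →₀ ℕ) :
    monomial a (1 : k) ∈ inIdeal I ↔ a ∈ leadSet I := by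
  classical
  rw [mem_inIdeal]
  simp [support_monomial]

lemma inIdeal_homog (I : Ideal (MvPolynomial (Fin n) k)) : IsHomog (inIdeal I) := by
  intro f hf d
  rw [mem_inIdeal] at hf ⊢
  intro a ha
  apply hf
  rw [mem_support_iff, coeff_homogeneousComponent] at ha
  rw [mem_support_iff]
  split_ifs at ha with h
  · exact ha
  · exact absurd rfl ha

lemma std_span (I : Ideal (MvPolynomial (Fin n) k)) (hI : IsHomog I) (s : ℕ)
    (a : Fin n →₀ ℕ) (ha : a.degree = s) :
    monomial a (1 : k) ∈ Submodule.span k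
      ((fun b => monomial b (1 : k)) '' {b : Fin n →₀ ℕ | b.degree = s ∧ b ∉ leadSet I}) ⊔
        I.restrictScalars k := by
  have hfin : Finite {b : Fin n →₀ ℕ // b.degree = s} := by
    have := (Finsupp.finite_of_degree_le (σ := Fin n) s)
    exact (this.subset (fun b (hb : b.degree = s) => hb.le)).to_subtype
  have wf : WellFounded (fun x y : {b : Fin n →₀ ℕ // b.degree = s} => drlt x.1 y.1) := by
    have : Std.Irrefl (fun x y : {b : Fin n →₀ ℕ // b.degree = s} => drlt x.1 y.1) :=
      ⟨fun x => drlt_irrefl _⟩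
    have : IsTrans _ (fun x y : {b : Fin n →₀ ℕ // b.degree = s} => drlt x.1 y.1) :=
      ⟨fun x y z => drlt_trans _ _ _⟩
    exact Finite.wellFounded_of_trans_of_irrefl _
  suffices H : ∀ x : {b : Fin n →₀ ℕ // b.degree = s}, monomial x.1 (1 : k) ∈ Submodule.span k
      ((fun b => monomial b (1 : k)) '' {b : Fin n →₀ ℕ | b.degree = s ∧ b ∉ leadSet I}) ⊔
        I.restrictScalars k from H ⟨a, ha⟩
  intro x
  induction x using wf.induction with
  | _ x ih =>
  by_cases hx : x.1 ∈ leadSet I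
  swap
  · exact Submodule.mem_sup_left (Submodule.subset_span ⟨x.1, ⟨x.2, hx⟩, rfl⟩)
  obtain ⟨f, hf, hx1, hx2⟩ := hx
  set P := Submodule.span k
      ((fun b => monomial b (1 : k)) '' {b : Fin n →₀ ℕ | b.degree = s ∧ b ∉ leadSet I}) ⊔
        I.restrictScalars k with hP
  set g := homogeneousComponent s f with hg
  have hgI : g ∈ P := Submodule.mem_sup_right (hI f hf s)
  have hcx : coeff x.1 g ≠ 0 := by
    rw [hg, coeff_homogeneousComponent, if_pos x.2]; exact mem_support_iff.1 hx1
  have hgsum : g = ∑ b ∈ g.support, coeff b g • monomial b (1 : k) := by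
    conv_lhs => rw [g.as_sum]
    refine Finset.sum_congr rfl fun b _ => ?_
    rw [smul_monomial, smul_eq_mul, mul_one]
  have hxs : x.1 ∈ g.support := mem_support_iff.2 hcx
  rw [← Finset.add_sum_erase _ _ hxs] at hgsum
  have hrest : ∑ b ∈ g.support.erase x.1, coeff b g • monomial b (1 : k) ∈ P := by
    refine Submodule.sum_mem _ fun b hb => Submodule.smul_mem _ _ ?_
    rw [Finset.mem_erase, mem_support_iff, hg, coeff_homogeneousComponent] at hb
    have hbd : b.degree = s := by
      by_contra h; rw [if_neg h] at hb; exact hb.2 rfl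
    rw [if_pos hbd] at hb
    exact ih ⟨b, hbd⟩ (hx2 b (mem_support_iff.2 hb.2) hb.1)
  have h1 : coeff x.1 g • monomial x.1 (1 : k) ∈ P := by
    have : coeff x.1 g • monomial x.1 (1 : k) =
      g - ∑ b ∈ g.support.erase x.1, coeff b g • monomial b (1 : k) := eq_sub_of_add_eq hgsum.symm
    rw [this]
    exact P.sub_mem hgI hrest
  exact (Submodule.smul_mem_iff _ hcx).1 h1

lemma hc_mul (v g : MvPolynomial (Fin n) k) (hv : v.IsHomogeneous 1) (s : ℕ) :
    homogeneousComponent (s + 1) (g * v) = homogeneousComponent s g * v := by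
  conv_lhs => rw [← sum_homogeneousComponent g, Finset.sum_mul, map_sum]
  have h1 : ∀ i, homogeneousComponent (s + 1) (homogeneousComponent i g * v) =
      if i = s then homogeneousComponent s g * v else 0 := by
    intro i
    have hm : homogeneousComponent i g * v ∈ homogeneousSubmodule (Fin n) k (i + 1) :=
      (homogeneousComponent_isHomogeneous i g).mul hv
    rw [homogeneousComponent_of_mem hm]
    by_cases h : i = s
    · subst h; simp
    · rw [if_neg (by omega), if_neg h]
  rw [Finset.sum_congr rfl (fun i _ => h1 i), Finset.sum_ite_eq']
  split_ifs with h
  · rfl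
  · rw [homogeneousComponent_eq_zero, zero_mul]
    simpa using h

lemma lin_decomp {ι : Type*} [Fintype ι] (v : ι → MvPolynomial (Fin n) k)
    (hv : ∀ i, (v i).IsHomogeneous 1) (J : Ideal (MvPolynomial (Fin n) k)) (hJ : IsHomog J)
    (s : ℕ) (p : MvPolynomial (Fin n) k) (hp : p.IsHomogeneous (s + 1))
    (h : p ∈ Ideal.span (Set.range v) ⊔ J) :
    ∃ g : ι → MvPolynomial (Fin n) k, (∀ i, (g i).IsHomogeneous s) ∧
      p - ∑ i, g i * v i ∈ J := by
  obtain ⟨y, hy, z, hz, rfl⟩ := Submodule.mem_sup.1 h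
  obtain ⟨c, rfl⟩ := Ideal.mem_span_range_iff_exists_fun.1 hy
  refine ⟨fun i => homogeneousComponent s (c i),
    fun i => homogeneousComponent_isHomogeneous _ _, ?_⟩
  have h2 := homogeneousComponent_eq_self hp
  rw [← h2, map_add, map_sum]
  simp only [hc_mul _ _ (hv _)]
  rw [add_sub_cancel_left]
  exact hJ z hz _

lemma maxPow_le (t : ℕ) (K : Ideal (MvPolynomial (Fin n) k)) :
    maxIdeal k n ^ t ≤ K ↔ ∀ a : Fin n →₀ ℕ, a.degree = t → monomial a (1 : k) ∈ K := by
  have : maxIdeal k n ^ t = Ideal.span ((monomial · (1 : k)) '' (Finsupp.degree ⁻¹' {t})) :=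
    pow_idealOfVars_eq_span t
  rw [this, Ideal.span_le]
  constructor
  · intro h a ha
    exact h ⟨a, ha, rfl⟩
  · rintro h _ ⟨a, ha, rfl⟩
    exact h a ha

lemma homog_mem_maxPow (t : ℕ) (p : MvPolynomial (Fin n) k) (hp : p.IsHomogeneous t) :
    p ∈ maxIdeal k n ^ t := by
  refine (mem_pow_idealOfVars_iff' t p).2 fun x hx => ?_
  exact hp.coeff_eq_zero hx.ne

lemma comap_map_mk (J K : Ideal (MvPolynomial (Fin n) k)) :
    (K.map (Ideal.Quotient.mk J)).comap (Ideal.Quotient.mk J) = K ⊔ J := by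
  rw [Ideal.comap_map_of_surjective' _ Ideal.Quotient.mk_surjective, Ideal.mk_ker]

lemma span_le_max {ι : Type*} (v : ι → MvPolynomial (Fin n) k)
    (hv : ∀ i, (v i).IsHomogeneous 1) : Ideal.span (Set.range v) ≤ maxIdeal k n := by
  rw [Ideal.span_le]
  rintro _ ⟨i, rfl⟩
  have := homog_mem_maxPow 1 (v i) (hv i)
  rwa [pow_one] at this

lemma red_iff {ι : Type*} [Fintype ι] (v : ι → MvPolynomial (Fin n) k)
    (hv : ∀ i, (v i).IsHomogeneous 1) (J : Ideal (MvPolynomial (Fin n) k)) (hJ : IsHomog J)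
    (r : ℕ) :
    maxIdealQ J ^ (r + 1) = Ideal.map (Ideal.Quotient.mk J) (Ideal.span (Set.range v)) *
      maxIdealQ J ^ r ↔ maxIdeal k n ^ (r + 1) ≤ Ideal.span (Set.range v) ⊔ J := by
  unfold maxIdealQ
  rw [← Ideal.map_pow, ← Ideal.map_pow, ← Ideal.map_mul]
  constructor
  · intro h
    have h1 := Ideal.le_comap_map (f := Ideal.Quotient.mk J) (I := maxIdeal k n ^ (r + 1))
    rw [h, comap_map_mk] at h1
    exact h1.trans (sup_le_sup_right Ideal.mul_le_left _)
  · intro h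
    apply le_antisymm
    · rw [Ideal.map_le_iff_le_comap, comap_map_mk, maxPow_le]
      intro a ha
      have h1 := (maxPow_le _ _).1 h a ha
      obtain ⟨g, hg, hgJ⟩ := lin_decomp v hv J hJ r _ (isHomogeneous_monomial 1 ha) h1
      rw [← sub_add_cancel (monomial a (1 : k)) (∑ i, g i * v i)]
      refine Ideal.add_mem _ (Ideal.mem_sup_right hgJ) (Ideal.mem_sup_left ?_)
      refine Ideal.sum_mem _ fun i _ => ?_
      rw [mul_comm (g i)]
      exact Ideal.mul_mem_mul (Ideal.subset_span ⟨i, rfl⟩) (homog_mem_maxPow r _ (hg i))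
    · apply Ideal.map_mono
      rw [pow_succ']
      exact Ideal.mul_mono_left (span_le_max v hv)

/-- the last variables -/
def vv (k : Type*) [Field k] (n d : ℕ) (l : {l : Fin n // n - d ≤ (l : ℕ)}) :
    MvPolynomial (Fin n) k := X l.1

lemma vv_homog (d : ℕ) (l) : (vv k n d l).IsHomogeneous 1 := isHomogeneous_X _ _

lemma range_vv (d : ℕ) : {f | ∃ l : Fin n, n - d ≤ (l : ℕ) ∧ f = X l} = Set.range (vv k n d) := by
  ext f
  constructor
  · rintro ⟨l, hl, rfl⟩; exact ⟨⟨l, hl⟩, rfl⟩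
  · rintro ⟨⟨l, hl⟩, rfl⟩; exact ⟨l, hl, rfl⟩

lemma mem_span_vv (d : ℕ) (p : MvPolynomial (Fin n) k) :
    p ∈ Ideal.span (Set.range (vv k n d)) ↔
      ∀ m ∈ p.support, ∃ l : Fin n, n - d ≤ (l : ℕ) ∧ m l ≠ 0 := by
  have : Set.range (vv k n d) = X '' {l : Fin n | n - d ≤ (l : ℕ)} := by
    rw [← range_vv]; ext f
    constructor
    · rintro ⟨l, hl, rfl⟩; exact ⟨l, hl, rfl⟩
    · rintro ⟨l, hl, rfl⟩; exact ⟨l, hl, rfl⟩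
  rw [this, mem_ideal_span_X_image]
  rfl

lemma key_iff (I : Ideal (MvPolynomial (Fin n) k)) (hI : IsHomog I) (d r : ℕ) :
    maxIdeal k n ^ (r + 1) ≤ Ideal.span (Set.range (vv k n d)) ⊔ I ↔
    maxIdeal k n ^ (r + 1) ≤ Ideal.span (Set.range (vv k n d)) ⊔ inIdeal I := by
  classical
  rw [maxPow_le, maxPow_le]
  constructor
  · intro h u hu
    by_cases hW : ∃ l : Fin n, n - d ≤ (l : ℕ) ∧ u l ≠ 0
    · apply Ideal.mem_sup_left
      rw [mem_span_vv]
      intro m hm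
      rw [support_monomial, if_neg one_ne_zero, Finset.mem_singleton] at hm
      rwa [hm]
    · apply Ideal.mem_sup_right
      rw [monomial_mem_inIdeal]
      obtain ⟨g, hg, hgI⟩ := lin_decomp _ (vv_homog d) I hI r _
        (isHomogeneous_monomial 1 hu) (h u hu)
      have hq : ∑ i, g i * vv k n d i ∈ Ideal.span (Set.range (vv k n d)) :=
        Ideal.sum_mem _ fun i _ => Ideal.mul_mem_left _ _ (Ideal.subset_span ⟨i, rfl⟩)
      have hqh : (∑ i, g i * vv k n d i).IsHomogeneous (r + 1) :=
        IsHomogeneous.sum _ _ _ fun i _ => (hg i).mul (vv_homog d i)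
      generalize ∑ i, g i * vv k n d i = q at hq hqh hgI
      rw [mem_span_vv] at hq
      have hqu : coeff u q = 0 := by
        by_contra hne
        exact hW (hq u (mem_support_iff.2 hne))
      refine ⟨_, hgI, ?_, ?_⟩
      · rw [mem_support_iff, coeff_sub, hqu, coeff_monomial, if_pos rfl]; simp
      · intro b hb hbu
        rw [mem_support_iff, coeff_sub, coeff_monomial, if_neg (Ne.symm hbu), zero_sub,
          neg_ne_zero] at hb
        obtain ⟨l, hl, hbl⟩ := hq b (mem_support_iff.2 hb)
        have hbd : b.degree = r + 1 := by
          by_contra hne; exact hb (hqh.coeff_eq_zero hne)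
        right
        refine ⟨by rw [adeg_eq, adeg_eq, hbd, hu], ?_⟩
        have hne : b.support.Nonempty := ⟨l, Finsupp.mem_support_iff.2 hbl⟩
        push Not at hW
        have hlm : l ≤ b.support.max' hne := Finset.le_max' _ _ (Finsupp.mem_support_iff.2 hbl)
        have hlm' : (l : ℕ) ≤ (b.support.max' hne : ℕ) := hlm
        refine ⟨b.support.max' hne, ?_, fun j hj => ?_⟩
        · rw [hW _ (by omega)]
          exact Nat.pos_of_ne_zero (Finsupp.mem_support_iff.1 (Finset.max'_mem _ hne))
        · have hj' : (b.support.max' hne : ℕ) < (j : ℕ) := hj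
          rw [hW j (by omega)]
          by_contra hbj
          exact absurd (Finset.le_max' _ _ (Finsupp.mem_support_iff.2 hbj)) (not_le.2 hj)
  · intro h u hu
    have h1 := std_span I hI (r + 1) u hu
    have h2 : Submodule.span k
      ((fun b => monomial b (1 : k)) '' {b : Fin n →₀ ℕ | b.degree = r + 1 ∧ b ∉ leadSet I}) ⊔
        I.restrictScalars k ≤
        (Ideal.span (Set.range (vv k n d)) ⊔ I).restrictScalars k := by
      refine sup_le ?_ ?_
      · rw [Submodule.span_le]
        rintro _ ⟨b, ⟨hb, hbI⟩, rfl⟩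
        refine Ideal.mem_sup_left ?_
        obtain ⟨y, hy, z, hz, hyz⟩ := Submodule.mem_sup.1 (h b hb)
        rw [mem_span_vv] at hy ⊢
        rw [mem_inIdeal] at hz
        intro m hm
        rw [support_monomial, if_neg one_ne_zero, Finset.mem_singleton] at hm
        subst hm
        apply hy
        rw [mem_support_iff]
        have hz0 : coeff m z = 0 := by
          by_contra hne
          exact hbI (hz m (mem_support_iff.2 hne))
        have := congrArg (coeff m) hyz
        rw [coeff_add, hz0, add_zero, coeff_monomial, if_pos rfl] at this
        rw [this]; exact one_ne_zero
      · intro x hx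
        exact Ideal.mem_sup_right hx
    exact h2 h1

/-- generators: products of a monomial in `v` and a monomial of degree at most `r` -/
def genSet {ι : Type*} (v : ι → MvPolynomial (Fin n) k) (r s : ℕ) :
    Set (MvPolynomial (Fin n) k) :=
  {q | ∃ (α : ι →₀ ℕ) (a : Fin n →₀ ℕ), α.degree ≤ s ∧ a.degree ≤ r ∧
    q = aeval v (monomial α (1 : k)) * monomial a (1 : k)}

lemma genSet_mono {ι : Type*} (v : ι → MvPolynomial (Fin n) k) (r : ℕ) {s t : ℕ} (h : s ≤ t) :
    genSet v r s ⊆ genSet v r t := by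
  rintro q ⟨α, a, h1, h2, h3⟩
  exact ⟨α, a, h1.trans h, h2, h3⟩

lemma gen_span {ι : Type*} [Fintype ι] (v : ι → MvPolynomial (Fin n) k)
    (hv : ∀ i, (v i).IsHomogeneous 1) (J : Ideal (MvPolynomial (Fin n) k)) (hJ : IsHomog J)
    (r : ℕ) (h : maxIdeal k n ^ (r + 1) ≤ Ideal.span (Set.range v) ⊔ J) (s : ℕ) :
    ∀ p : MvPolynomial (Fin n) k, p.IsHomogeneous s →
      p ∈ Submodule.span k (genSet v r s) ⊔ J.restrictScalars k := by
  have base : ∀ s ≤ r, ∀ p : MvPolynomial (Fin n) k, p.IsHomogeneous s →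
      p ∈ Submodule.span k (genSet v r s) ⊔ J.restrictScalars k := by
    intro s hs p hp
    apply Submodule.mem_sup_left
    rw [p.as_sum]
    refine Submodule.sum_mem _ fun a ha => ?_
    have : monomial a (coeff a p) = coeff a p • monomial a (1 : k) := by
      rw [smul_monomial, smul_eq_mul, mul_one]
    rw [this]
    refine Submodule.smul_mem _ _ (Submodule.subset_span ⟨0, a, by simp, ?_, by simp⟩)
    have : a.degree = s := by
      by_contra hne; exact mem_support_iff.1 ha (hp.coeff_eq_zero hne)
    omega
  induction s with
  | zero => exact base 0 (Nat.zero_le _)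
  | succ s ih =>
    intro p hp
    by_cases hs : s + 1 ≤ r
    · exact base _ hs p hp
    have hp' : p ∈ Ideal.span (Set.range v) ⊔ J :=
      h (Ideal.pow_le_pow_right (by omega) (homog_mem_maxPow _ _ hp))
    obtain ⟨g, hg, hgJ⟩ := lin_decomp v hv J hJ s p hp hp'
    rw [← sub_add_cancel p (∑ i, g i * v i)]
    refine Submodule.add_mem _ (Submodule.mem_sup_right hgJ) (Submodule.sum_mem _ fun i _ => ?_)
    obtain ⟨y, hy, z, hz, hyz⟩ := Submodule.mem_sup.1 (ih (g i) (hg i))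
    rw [← hyz, add_mul]
    refine Submodule.add_mem _ (Submodule.mem_sup_left ?_)
      (Submodule.mem_sup_right (J.mul_mem_right _ hz))
    have hmap : Submodule.span k (genSet v r s) ≤
        (Submodule.span k (genSet v r (s + 1))).comap (LinearMap.mulRight k (v i)) := by
      rw [Submodule.span_le]
      rintro q ⟨α, a, h1, h2, rfl⟩
      refine Submodule.subset_span ⟨α + Finsupp.single i 1, a, ?_, h2, ?_⟩
      · rw [map_add, Finsupp.degree_single]; omega
      · have : monomial (α + Finsupp.single i 1) (1 : k) = monomial α 1 * X i := by
          rw [X, monomial_mul, one_mul]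
        rw [LinearMap.mulRight_apply, this, map_mul (aeval v), aeval_X]
        ring
    exact hmap hy

lemma card_le_of_li {ι κ M : Type*} [AddCommGroup M] [Module k M] [Finite κ]
    (v : ι → M) (f : κ → M) (hv : LinearIndependent k v)
    (h : ∀ i, v i ∈ Submodule.span k (Set.range f)) : Nat.card ι ≤ Nat.card κ := by
  classical
  have := Fintype.ofFinite κ
  have hr : Set.range v ≤ Submodule.span k (Set.range f) := by
    rintro _ ⟨i, rfl⟩; exact h i
  have : Finite ι := hv.finite_of_le_span_finite v _ hr
  have := Fintype.ofFinite ι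
  have h1 := linearIndependent_le_span_aux' v hv (Set.range f) hr
  rw [Nat.card_eq_fintype_card, Nat.card_eq_fintype_card]
  exact h1.trans (Fintype.card_range_le f)

lemma ker_zero (I : Ideal (MvPolynomial (Fin n) k)) (hI : IsHomog I) (d r : ℕ)
    (hd : ringKrullDim (MvPolynomial (Fin n) k ⧸ I) = ((d : ℕ∞) : WithBot ℕ∞))
    (h : maxIdeal k n ^ (r + 1) ≤ Ideal.span (Set.range (vv k n d)) ⊔ I) :
    Nat.card {l : Fin n // n - d ≤ (l : ℕ)} = d ∧
    Function.Injective (aeval (R := k) (fun l => Ideal.Quotient.mk I (vv k n d l))) := by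
  classical
  set φ : MvPolynomial {l : Fin n // n - d ≤ (l : ℕ)} k →ₐ[k] MvPolynomial (Fin n) k ⧸ I :=
    aeval (R := k) (fun l => Ideal.Quotient.mk I (vv k n d l)) with hφ
  have hφ' : ∀ p, φ p = Ideal.Quotient.mk I (aeval (vv k n d) p) := by
    intro p
    have : φ = (Ideal.Quotient.mkₐ k I).comp (aeval (vv k n d)) := by
      apply algHom_ext; intro i; simp [hφ]
    rw [this]; rfl
  have hcard : Nat.card {l : Fin n // n - d ≤ (l : ℕ)} ≤ d := by
    have : Function.Injective
        (fun l : {l : Fin n // n - d ≤ (l : ℕ)} => (⟨n - 1 - l.1, by omega⟩ : Fin d)) := by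
      intro a b hab
      simp only [Fin.mk.injEq] at hab
      ext; omega
    simpa using Nat.card_le_card_of_injective _ this
  have hdimA : ringKrullDim (MvPolynomial {l : Fin n // n - d ≤ (l : ℕ)} k) =
      (Nat.card {l : Fin n // n - d ≤ (l : ℕ)} : WithBot ℕ∞) := by
    rw [MvPolynomial.ringKrullDim_of_isNoetherianRing, ringKrullDim_eq_zero_of_field, zero_add]
  let R₀ := φ.toRingHom.range
  have hint : φ.toRingHom.IsIntegral := by
    apply RingHom.IsIntegral.of_finite
    let := φ.toRingHom.toAlgebra
    change Module.Finite _ _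
    refine ⟨⟨((Finsupp.finite_of_degree_le (σ := Fin n) r).toFinset.image
      (fun a => Ideal.Quotient.mk I (monomial a (1 : k)))), ?_⟩⟩
    rw [eq_top_iff]
    rintro x -
    obtain ⟨p, rfl⟩ := Ideal.Quotient.mk_surjective x
    rw [← sum_homogeneousComponent p, map_sum]
    refine Submodule.sum_mem _ fun i _ => ?_
    obtain ⟨y, hy, z, hz, hyz⟩ := Submodule.mem_sup.1 (gen_span _ (vv_homog d) I hI r h i _
      (homogeneousComponent_isHomogeneous i p))
    rw [← hyz, map_add, Ideal.Quotient.eq_zero_iff_mem.2 hz, add_zero]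
    clear hyz
    induction hy using Submodule.span_induction with
    | mem q hq =>
      obtain ⟨α, a, -, ha, rfl⟩ := hq
      rw [map_mul, ← hφ']
      have : φ (monomial α 1) * Ideal.Quotient.mk I (monomial a (1 : k)) =
        (monomial α (1 : k)) • Ideal.Quotient.mk I (monomial a (1 : k)) := rfl
      rw [this]
      refine Submodule.smul_mem _ _ (Submodule.subset_span ?_)
      simp only [Finset.coe_image, Set.mem_image]
      exact ⟨a, by simpa using ha, rfl⟩
    | zero => rw [map_zero]; exact Submodule.zero_mem _
    | add x y _ _ hx hy => rw [map_add]; exact Submodule.add_mem _ hx hy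
    | smul c x _ hx =>
      have : Ideal.Quotient.mk I (c • x) = (C c : MvPolynomial {l : Fin n // n - d ≤ (l : ℕ)} k) •
          Ideal.Quotient.mk I x := by
        change _ = φ (C c) * _
        rw [hφ', smul_eq_C_mul, map_mul]; simp
      rw [this]
      exact Submodule.smul_mem _ _ hx
  have hle : ringKrullDim (MvPolynomial (Fin n) k ⧸ I) ≤ ringKrullDim R₀ := by
    have hint' : Algebra.IsIntegral R₀ (MvPolynomial (Fin n) k ⧸ I) := by
      refine ⟨fun x => ?_⟩
      have : (R₀.subtype.comp φ.toRingHom.rangeRestrict).IsIntegralElem x := hint x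
      exact RingHom.IsIntegralElem.of_comp this
    refine Order.krullDim_le_of_strictMono
      (fun P => ⟨Ideal.comap (algebraMap R₀ _) P.asIdeal, inferInstance⟩) ?_
    intro P Q hPQ
    change Ideal.comap (algebraMap R₀ _) P.asIdeal < Ideal.comap (algebraMap R₀ _) Q.asIdeal
    exact Ideal.IsIntegral.comap_lt_comap hPQ
  have hsurj : Function.Surjective φ.toRingHom.rangeRestrict := RingHom.rangeRestrict_surjective _
  have hle2 := ringKrullDim_le_of_surjective _ hsurj
  rw [hdimA] at hle2
  rw [hd] at hle
  have hdc : d ≤ Nat.card {l : Fin n // n - d ≤ (l : ℕ)} := by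
    exact_mod_cast hle.trans hle2
  refine ⟨le_antisymm hcard hdc, ?_⟩
  rw [injective_iff_map_eq_zero]
  intro f hf
  by_contra hne
  have h3 := ringKrullDim_succ_le_of_surjective _ hsurj (mem_nonZeroDivisors_of_ne_zero hne)
    (Subtype.ext hf)
  rw [hdimA] at h3
  have h4 : ((d : ℕ∞) : WithBot ℕ∞) + 1 ≤
      ((Nat.card {l : Fin n // n - d ≤ (l : ℕ)} : ℕ) : WithBot ℕ∞) :=
    (add_le_add_left hle 1).trans h3
  have h5 : d + 1 ≤ Nat.card {l : Fin n // n - d ≤ (l : ℕ)} := by exact_mod_cast h4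
  omega

lemma fin_deg {ι : Type*} [Finite ι] (T : ℕ) : Finite {α : ι →₀ ℕ // α.degree ≤ T} :=
  (Finsupp.finite_of_degree_le (σ := ι) T).to_subtype

lemma le_degree' {ι : Type*} (α : ι →₀ ℕ) (i : ι) : α i ≤ α.degree :=
  Finsupp.le_degree i α

lemma card_deg_le (e T : ℕ) : Nat.card {α : Fin e →₀ ℕ // α.degree ≤ T} ≤ (T + 1) ^ e := by
  have hinj : Function.Injective (fun (α : {α : Fin e →₀ ℕ // α.degree ≤ T}) (i : Fin e) =>
      (⟨α.1 i, by have := le_degree' α.1 i; have := α.2; omega⟩ : Fin (T + 1))) := by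
    intro α β h
    ext i
    have := congrFun h i
    simpa using this
  simpa using Nat.card_le_card_of_injective _ hinj

lemma le_card_deg {ι : Type*} [Fintype ι] (t : ℕ) :
    (t + 1) ^ (Fintype.card ι) ≤
      Nat.card {α : ι →₀ ℕ // α.degree ≤ Fintype.card ι * t} := by
  classical
  have := fin_deg (ι := ι) (Fintype.card ι * t)
  have hinj : Function.Injective (fun (f : ι → Fin (t + 1)) =>
      (⟨Finsupp.equivFunOnFinite.symm (fun i => (f i : ℕ)), by
        rw [Finsupp.degree_eq_sum]
        calc _ ≤ ∑ i : ι, t := Finset.sum_le_sum fun i _ => by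
              have := (f i).2
              simp only [Finsupp.coe_equivFunOnFinite_symm]; omega
          _ = _ := by simp⟩ : {α : ι →₀ ℕ // α.degree ≤ Fintype.card ι * t})) := by
    intro f g h
    simp only [Subtype.mk.injEq, EmbeddingLike.apply_eq_iff_eq] at h
    funext i
    exact Fin.ext (congrFun h i)
  simpa using Nat.card_le_card_of_injective _ hinj

lemma arith_aux (d e C : ℕ) (h : ∀ t, (t + 1) ^ d ≤ (d * t + 1) ^ e * C) : d ≤ e := by
  by_contra hlt
  push Not at hlt
  set t := (d + 1) ^ e * C with ht
  have h1 : (t + 1) ^ (e + 1) ≤ (t + 1) ^ d := Nat.pow_le_pow_right (by omega) hlt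
  have h2 : (d * t + 1) ^ e ≤ ((d + 1) * (t + 1)) ^ e := Nat.pow_le_pow_left (by nlinarith) e
  have h3 : (t + 1) ^ e * (t + 1) ≤ (t + 1) ^ e * t := by
    calc (t + 1) ^ e * (t + 1) = (t + 1) ^ (e + 1) := (pow_succ _ _).symm
      _ ≤ (d * t + 1) ^ e * C := h1.trans (h t)
      _ ≤ ((d + 1) * (t + 1)) ^ e * C := Nat.mul_le_mul_right _ h2
      _ = (t + 1) ^ e * ((d + 1) ^ e * C) := by rw [mul_pow]; ring
      _ = (t + 1) ^ e * t := by rw [← ht]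
  have := Nat.le_of_mul_le_mul_left h3 (by positivity)
  omega

lemma count (I : Ideal (MvPolynomial (Fin n) k)) (hI : IsHomog I) {ι : Type*} [Fintype ι]
    (w : ι → MvPolynomial (Fin n) k) (hw : ∀ i, (w i).IsHomogeneous 1)
    (hinj : Function.Injective (aeval (R := k) (fun l => Ideal.Quotient.mk I (w l))))
    (e r : ℕ) (v : Fin e → MvPolynomial (Fin n) k) (hv : ∀ i, (v i).IsHomogeneous 1)
    (h : maxIdeal k n ^ (r + 1) ≤ Ideal.span (Set.range v) ⊔ inIdeal I) :
    Fintype.card ι ≤ e := by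
  classical
  apply arith_aux _ _ (Nat.card {a : Fin n →₀ ℕ // a.degree ≤ r})
  intro t
  refine (le_card_deg t).trans ?_
  set T := Fintype.card ι * t
  have hstdfin : Finite {b : Fin n →₀ ℕ // b.degree ≤ T ∧ b ∉ leadSet I} :=
    ((Finsupp.finite_of_degree_le (σ := Fin n) T).subset (fun b hb => hb.1)).to_subtype
  have hA : Nat.card {α : ι →₀ ℕ // α.degree ≤ T} ≤
      Nat.card {b : Fin n →₀ ℕ // b.degree ≤ T ∧ b ∉ leadSet I} := by
    set φ := aeval (R := k) (fun l => Ideal.Quotient.mk I (w l)) with hφ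
    have hφ' : ∀ p, φ p = Ideal.Quotient.mk I (aeval w p) := by
      intro p
      have : φ = (Ideal.Quotient.mkₐ k I).comp (aeval w) := by
        apply algHom_ext; intro i; simp [hφ]
      rw [this]; rfl
    refine card_le_of_li (k := k) (fun α => φ (monomial α.1 1))
      (fun b => Ideal.Quotient.mkₐ k I (monomial b.1 1)) ?_ ?_
    · have h1 : LinearIndependent k
          (fun α : {α : ι →₀ ℕ // α.degree ≤ T} => (monomial α.1 (1 : k) : MvPolynomial ι k)) := by
        have := (basisMonomials ι k).linearIndependent.comp
          (Subtype.val : {α : ι →₀ ℕ // α.degree ≤ T} → _) Subtype.val_injective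
        simpa [Function.comp_def] using this
      exact h1.map' φ.toLinearMap (LinearMap.ker_eq_bot.2 hinj)
    · intro α
      have hhom : (aeval w (monomial α.1 (1 : k))).IsHomogeneous α.1.degree := by
        have := (isHomogeneous_monomial (1 : k) (rfl : α.1.degree = α.1.degree)).aeval w hw
        simpa using this
      rw [hφ']
      generalize aeval w (monomial α.1 (1 : k)) = p at hhom
      have hle : Submodule.span k ((fun b => monomial b (1 : k)) ''
          {b : Fin n →₀ ℕ | b.degree = α.1.degree ∧ b ∉ leadSet I}) ⊔ I.restrictScalars k ≤
          (Submodule.span k (Set.range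
            (fun b : {b : Fin n →₀ ℕ // b.degree ≤ T ∧ b ∉ leadSet I} =>
              Ideal.Quotient.mkₐ k I (monomial b.1 1)))).comap
              (Ideal.Quotient.mkₐ k I).toLinearMap := by
        refine sup_le ?_ ?_
        · rw [Submodule.span_le]
          rintro _ ⟨b, ⟨hb, hb'⟩, rfl⟩
          exact Submodule.subset_span ⟨⟨b, hb.le.trans α.2, hb'⟩, rfl⟩
        · intro x hx
          have : Ideal.Quotient.mkₐ k I x = 0 := Ideal.Quotient.eq_zero_iff_mem.2 hx
          rw [Submodule.mem_comap, AlgHom.toLinearMap_apply, this]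
          exact Submodule.zero_mem _
      refine hle ?_
      rw [p.as_sum]
      refine Submodule.sum_mem _ fun a ha => ?_
      have : monomial a (coeff a p) = coeff a p • monomial a (1 : k) := by
        rw [smul_monomial, smul_eq_mul, mul_one]
      rw [this]
      refine Submodule.smul_mem _ _ (std_span I hI _ a ?_)
      by_contra hne
      exact mem_support_iff.1 ha (hhom.coeff_eq_zero hne)
  have hB : Nat.card {b : Fin n →₀ ℕ // b.degree ≤ T ∧ b ∉ leadSet I} ≤
      Nat.card ({β : Fin e →₀ ℕ // β.degree ≤ T} × {a : Fin n →₀ ℕ // a.degree ≤ r}) := by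
    have := fin_deg (ι := Fin e) T
    have := fin_deg (ι := Fin n) r
    refine card_le_of_li (k := k) (fun b => Ideal.Quotient.mkₐ k (inIdeal I) (monomial b.1 1))
      (fun x => Ideal.Quotient.mkₐ k (inIdeal I)
        (aeval v (monomial x.1.1 (1 : k)) * monomial x.2.1 (1 : k))) ?_ ?_
    · rw [linearIndependent_iff']
      intro s g hg b hb
      have h1 : ∑ i ∈ s, g i • monomial i.1 (1 : k) ∈ inIdeal I := by
        rw [← Ideal.Quotient.eq_zero_iff_mem, ← Ideal.Quotient.mkₐ_eq_mk k, map_sum, ← hg]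
        simp only [map_smul]
      rw [mem_inIdeal] at h1
      by_contra hne
      refine b.2.2 (h1 b.1 ?_)
      rw [mem_support_iff, coeff_sum, Finset.sum_eq_single b]
      · simpa [coeff_monomial] using hne
      · intro c _ hcb
        rw [coeff_smul, coeff_monomial, if_neg (fun hh => hcb (Subtype.ext hh)), smul_zero]
      · intro hh; exact absurd hb hh
    · intro b
      obtain ⟨y, hy, z, hz, hyz⟩ := Submodule.mem_sup.1 (gen_span v hv _ (inIdeal_homog I) r h
        b.1.degree _ (isHomogeneous_monomial (1 : k) rfl))
      rw [← hyz, map_add]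
      have hz0 : Ideal.Quotient.mkₐ k (inIdeal I) z = 0 := Ideal.Quotient.eq_zero_iff_mem.2 hz
      rw [hz0, add_zero]
      have hle : Submodule.span k (genSet v r b.1.degree) ≤ (Submodule.span k (Set.range
        (fun x : {β : Fin e →₀ ℕ // β.degree ≤ T} × {a : Fin n →₀ ℕ // a.degree ≤ r} =>
          Ideal.Quotient.mkₐ k (inIdeal I)
        (aeval v (monomial x.1.1 (1 : k)) * monomial x.2.1 (1 : k))))).comap
          (Ideal.Quotient.mkₐ k (inIdeal I)).toLinearMap := by
        rw [Submodule.span_le]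
        rintro q ⟨α, a, hα, ha, rfl⟩
        exact Submodule.subset_span ⟨(⟨α, hα.trans b.2.1⟩, ⟨a, ha⟩), rfl⟩
      exact hle hy
  rw [Nat.card_prod] at hB
  exact hA.trans (hB.trans (Nat.mul_le_mul_right _ (card_deg_le e T)))

lemma lin_part (d : ℕ) (g : MvPolynomial (Fin n) k)
    (hg : g ∈ Ideal.span (Set.range (vv k n d))) :
    homogeneousComponent 1 g ∈ Submodule.span k (Set.range (vv k n d)) ∧
      g - homogeneousComponent 1 g ∈ maxIdeal k n * Ideal.span (Set.range (vv k n d)) := by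
  obtain ⟨c, rfl⟩ := Ideal.mem_span_range_iff_exists_fun.1 hg
  have h1 : homogeneousComponent 1 (∑ i, c i * vv k n d i) =
      ∑ i, C (coeff 0 (c i)) * vv k n d i := by
    rw [map_sum]
    refine Finset.sum_congr rfl fun i _ => ?_
    have := hc_mul (vv k n d i) (c i) (vv_homog d i) 0
    rw [zero_add] at this
    rw [this, homogeneousComponent_zero]
  rw [h1]
  constructor
  · refine Submodule.sum_mem _ fun i _ => ?_
    rw [← smul_eq_C_mul]
    exact Submodule.smul_mem _ _ (Submodule.subset_span ⟨i, rfl⟩)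
  · rw [← Finset.sum_sub_distrib]
    refine Ideal.sum_mem _ fun i _ => ?_
    rw [← sub_mul]
    refine Ideal.mul_mem_mul ?_ (Ideal.subset_span ⟨i, rfl⟩)
    have : c i - C (coeff 0 (c i)) ∈ maxIdeal k n ^ 1 := by
      refine (mem_pow_idealOfVars_iff' 1 _).2 fun x hx => ?_
      have hx0 : x = 0 := by
        rw [← Finsupp.degree_eq_zero_iff]; omega
      subst hx0
      simp
    rwa [pow_one] at this

lemma min_aux (I : Ideal (MvPolynomial (Fin n) k)) (hI : IsHomog I) (d : ℕ)
    (hcard : Nat.card {l : Fin n // n - d ≤ (l : ℕ)} = d)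
    (hinj : Function.Injective (aeval (R := k) (fun l => Ideal.Quotient.mk I (vv k n d l))))
    (J : Ideal (MvPolynomial (Fin n) k)) (hJI : J = inIdeal I)
    (B : Ideal (MvPolynomial (Fin n) k)) (hJB : J ≤ B)
    (hB : B ≤ Ideal.span (Set.range (vv k n d)) ⊔ J) (r : ℕ)
    (hr : maxIdeal k n ^ (r + 1) ≤ B * maxIdeal k n ^ r ⊔ J) :
    Ideal.span (Set.range (vv k n d)) ≤ B := by
  have hJ : IsHomog J := hJI ▸ inIdeal_homog I
  set M := maxIdeal k n with hM
  set W := Ideal.span (Set.range (vv k n d)) with hW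
  have hWM : W ≤ M := span_le_max _ (vv_homog d)
  have hMW : M * W ≤ M ^ 2 := by
    rw [pow_two]; exact Ideal.mul_mono_right hWM
  set L := Submodule.span k (Set.range (vv k n d)) with hL
  have hLfin : Module.Finite k L := Module.Finite.span_of_finite k (Set.finite_range _)
  set V : Submodule k (MvPolynomial (Fin n) k) := L ⊓ (B ⊔ M ^ 2).restrictScalars k with hV
  have hVL : V ≤ L := inf_le_left
  have hVfin : Module.Finite k V := Submodule.finiteDimensional_of_le hVL
  have hLhom : L ≤ homogeneousSubmodule (Fin n) k 1 := by
    rw [hL, Submodule.span_le]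
    rintro _ ⟨i, rfl⟩
    exact vv_homog d i
  set bs := Module.finBasis k V with hbs
  set v : Fin (Module.finrank k V) → MvPolynomial (Fin n) k := fun i => (bs i).1 with hv
  have hvhom : ∀ i, (v i).IsHomogeneous 1 := fun i => hLhom (hVL (bs i).2)
  have hVv : ∀ x ∈ V, x ∈ Ideal.span (Set.range v) := by
    intro x hx
    have := bs.sum_repr ⟨x, hx⟩
    have h2 : x = ∑ i, (bs.repr ⟨x, hx⟩ i) • v i := by
      have h3 := (congrArg Subtype.val this).symm
      refine Eq.trans h3 ?_
      rw [Submodule.coe_sum]; rfl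
    rw [h2]
    refine Ideal.sum_mem _ fun i _ => ?_
    rw [smul_eq_C_mul]
    exact Ideal.mul_mem_left _ _ (Ideal.subset_span ⟨i, rfl⟩)
  have hBv : B ≤ (Ideal.span (Set.range v) ⊔ J) ⊔ M ^ 2 := by
    intro g hg
    obtain ⟨y, hy, z, hz, rfl⟩ := Submodule.mem_sup.1 (hB hg)
    obtain ⟨h1, h2⟩ := lin_part d y hy
    have h3 : homogeneousComponent 1 y ∈ V := by
      refine ⟨h1, ?_⟩
      have : homogeneousComponent 1 y = (y + z) - z - (y - homogeneousComponent 1 y) := by ring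
      rw [this]
      exact Ideal.sub_mem _ (Ideal.sub_mem _ (Ideal.mem_sup_left hg) (Ideal.mem_sup_left (hJB hz)))
        (Ideal.mem_sup_right (hMW h2))
    have : y + z = (homogeneousComponent 1 y + z) + (y - homogeneousComponent 1 y) := by ring
    rw [this]
    exact Ideal.add_mem _ (Ideal.mem_sup_left (Ideal.add_mem _ (Ideal.mem_sup_left (hVv _ h3))
      (Ideal.mem_sup_right hz))) (Ideal.mem_sup_right (hMW h2))
  have hMr : M ^ (r + 1) ≤ Ideal.span (Set.range v) ⊔ J := by
    have h1 : M ^ (r + 1) ≤ (Ideal.span (Set.range v) ⊔ J) ⊔ M ^ (r + 2) := by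
      refine hr.trans (sup_le ?_ (le_sup_right.trans le_sup_left))
      refine (Ideal.mul_mono_left hBv).trans ?_
      rw [Ideal.sup_mul]
      refine sup_le_sup Ideal.mul_le_left ?_
      rw [← pow_add, add_comm]
    rw [hM, maxPow_le]
    intro a ha
    have h2 := (maxPow_le _ _).1 h1 a ha
    obtain ⟨y, hy, z, hz, hyz⟩ := Submodule.mem_sup.1 h2
    have h3 := homogeneousComponent_eq_self (isHomogeneous_monomial (1 : k) ha)
    have hz0 : homogeneousComponent (r + 1) z = 0 := by
      ext m
      rw [coeff_homogeneousComponent, coeff_zero]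
      split_ifs with hm
      · exact (mem_pow_idealOfVars_iff' (r + 2) z).1 hz m (by omega)
      · rfl
    rw [← h3, ← hyz, map_add, hz0, add_zero]
    obtain ⟨y1, hy1, y2, hy2, rfl⟩ := Submodule.mem_sup.1 hy
    rw [map_add]
    refine Ideal.add_mem _ (Ideal.mem_sup_left ?_) (Ideal.mem_sup_right (hJ _ hy2 _))
    obtain ⟨c, rfl⟩ := Ideal.mem_span_range_iff_exists_fun.1 hy1
    rw [map_sum]
    refine Ideal.sum_mem _ fun i _ => ?_
    rw [hc_mul _ _ (hvhom i)]
    exact Ideal.mul_mem_left _ _ (Ideal.subset_span ⟨i, rfl⟩)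
  have hcount := count I hI (vv k n d) (vv_homog d) hinj _ r v hvhom (hJI ▸ hMr)
  have hVeq : V = L := by
    apply Submodule.eq_of_le_of_finrank_le hVL
    refine le_trans ?_ hcount
    exact finrank_range_le_card (R := k) (vv k n d)
  have hstep : W ≤ B ⊔ M * W := by
    rw [hW, Ideal.span_le]
    rintro _ ⟨l, rfl⟩
    have hl : vv k n d l ∈ V := by
      rw [hVeq]; exact Submodule.subset_span ⟨l, rfl⟩
    obtain ⟨b, hb, q, hq, hbq⟩ := Submodule.mem_sup.1 hl.2
    have hqW : q ∈ W ⊔ J := by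
      have : q = vv k n d l - b := by rw [← hbq]; ring
      rw [this]
      exact Ideal.sub_mem _ (Ideal.mem_sup_left (Ideal.subset_span ⟨l, rfl⟩)) (hB hb)
    obtain ⟨y, hy, z, hz, hyz⟩ := Submodule.mem_sup.1 hqW
    obtain ⟨h1, h2⟩ := lin_part d y hy
    have hq0 : homogeneousComponent 1 q = 0 := by
      ext m
      rw [coeff_homogeneousComponent, coeff_zero]
      split_ifs with hm
      · exact (mem_pow_idealOfVars_iff' 2 q).1 hq m (by omega)
      · rfl
    have h4 : homogeneousComponent 1 y ∈ J := by
      rw [← hyz, map_add] at hq0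
      rw [eq_neg_of_add_eq_zero_left hq0]
      exact J.neg_mem (hJ z hz 1)
    have : vv k n d l = (b + z + homogeneousComponent 1 y) + (y - homogeneousComponent 1 y) := by
      rw [← hbq, ← hyz]; ring
    rw [this]
    exact Ideal.add_mem _ (Ideal.mem_sup_left
      (Ideal.add_mem _ (Ideal.add_mem _ hb (hJB hz)) (hJB h4))) (Ideal.mem_sup_right h2)
  have hiter : ∀ s : ℕ, W ≤ B ⊔ M ^ s * W := by
    intro s
    induction s with
    | zero => simp
    | succ s ih =>
      refine ih.trans (sup_le le_sup_left ?_)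
      refine (Ideal.mul_mono_right hstep).trans ?_
      rw [Ideal.mul_sup, ← mul_assoc, ← pow_succ]
      exact sup_le_sup_right Ideal.mul_le_right _
  refine (hiter (r + 1)).trans (sup_le le_rfl (Ideal.mul_le_left.trans ?_))
  exact hr.trans (sup_le Ideal.mul_le_left hJB)

end Helpers

/-- Lemma 4.1: let `d = dim S/I` and suppose `𝔞 = (I, xₙ, …, x_{n-d+1})/I` is a minimal
reduction of the maximal graded ideal `𝔪` of `S/I`. Then, for the reverse lexicographic
order, `𝔟 = (in(I), xₙ, …, x_{n-d+1})/in(I)` is a minimal reduction of the maximal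
graded ideal of `S/in(I)` and `r_𝔞(S/I) = r_𝔟(S/in(I))`. -/
theorem statement14 {k : Type*} [Field k] {n : ℕ}
    (I : Ideal (MvPolynomial (Fin n) k)) (hI : IsHomog I) (d : ℕ)
    (hd : ringKrullDim (MvPolynomial (Fin n) k ⧸ I) = ((d : ℕ∞) : WithBot ℕ∞))
    (ha : IsMinimalReduction (maxIdealQ I)
      (Ideal.map (Ideal.Quotient.mk I)
        (Ideal.span {f | ∃ l : Fin n, n - d ≤ (l : ℕ) ∧ f = X l}))) :
    IsMinimalReduction (maxIdealQ (inIdeal I))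
      (Ideal.map (Ideal.Quotient.mk (inIdeal I))
        (Ideal.span {f | ∃ l : Fin n, n - d ≤ (l : ℕ) ∧ f = X l})) ∧
    redNum (maxIdealQ I)
      (Ideal.map (Ideal.Quotient.mk I)
        (Ideal.span {f | ∃ l : Fin n, n - d ≤ (l : ℕ) ∧ f = X l})) =
    redNum (maxIdealQ (inIdeal I))
      (Ideal.map (Ideal.Quotient.mk (inIdeal I))
        (Ideal.span {f | ∃ l : Fin n, n - d ≤ (l : ℕ) ∧ f = X l})) := by
  rw [range_vv] at ha ⊢
  obtain ⟨⟨ha1, N, hN⟩, -⟩ := ha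
  have hiff : ∀ r, maxIdealQ I ^ (r + 1) =
      Ideal.map (Ideal.Quotient.mk I) (Ideal.span (Set.range (vv k n d))) * maxIdealQ I ^ r ↔
      maxIdealQ (inIdeal I) ^ (r + 1) =
      Ideal.map (Ideal.Quotient.mk (inIdeal I)) (Ideal.span (Set.range (vv k n d))) *
        maxIdealQ (inIdeal I) ^ r := by
    intro r
    rw [red_iff _ (vv_homog d) I hI, red_iff _ (vv_homog d) _ (inIdeal_homog I),
      key_iff I hI]
  obtain ⟨hcard, hinj⟩ := ker_zero I hI d N hd
    ((red_iff _ (vv_homog d) I hI N).1 (hN N le_rfl))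
  refine ⟨⟨⟨Ideal.map_mono (span_le_max _ (vv_homog d)), N, fun r hr => (hiff r).1 (hN r hr)⟩,
    ?_⟩, ?_⟩
  · rintro B ⟨-, r, hr⟩ hBle
    refine le_antisymm hBle ?_
    have hr := hr r le_rfl
    set B' := B.comap (Ideal.Quotient.mk (inIdeal I)) with hB'
    have hBB : B = B'.map (Ideal.Quotient.mk (inIdeal I)) :=
      (Ideal.map_comap_of_surjective _ Ideal.Quotient.mk_surjective B).symm
    rw [Ideal.map_le_iff_le_comap]
    refine min_aux I hI d hcard hinj (inIdeal I) rfl B' ?_ ?_ r ?_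
    · intro x hx
      rw [hB', Ideal.mem_comap, Ideal.Quotient.eq_zero_iff_mem.2 hx]
      exact B.zero_mem
    · rw [← comap_map_mk]
      exact Ideal.comap_mono hBle
    · unfold maxIdealQ at hr
      rw [hBB, ← Ideal.map_pow, ← Ideal.map_pow, ← Ideal.map_mul] at hr
      rw [← comap_map_mk, ← hr]
      exact Ideal.le_comap_map
  · unfold redNum
    congr 1
    ext r
    exact hiff r
end
end Paper
end

section
/- Let k be an infinite field and I a homogeneous ideal of S = k[x_1,…,x_n] with d = dim S/I. Then there is a nonempty Zariski open subset of (k^n)^d such that for every choice of linear forms y_1,…,y_d with coefficient tuple in this open set, 𝔞 = (I, y_1,…,y_d)/I is a minimal reduction of the maximal graded ideal 𝔪 of S/I with r_𝔞(S/I) = r(S/I). -/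
set_option synthInstance.maxHeartbeats 1000000
set_option maxHeartbeats 1000000

/-! Common definitions: gradings, term orders, initial ideals, generic initial ideals,
Borel-fixed ideals, filter-regular sequences, a Koszul/Čech-type description of graded
local cohomology and the invariants `a_i`, `reg_t`, `a*_t`, minimal graded free
resolutions, and reductions. -/

namespace Paper

open MvPolynomial

noncomputable section

variable {k : Type*} [Field k] {n : ℕ}

theorem ne_lift {A R : Type*} [CommRing A] [CommRing R] [Algebra A R] [Algebra.IsIntegral A R]
    (hinj : Function.Injective (algebraMap A R)) (p : LTSeries (PrimeSpectrum A)) :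
    ∃ q : LTSeries (PrimeSpectrum R), q.length = p.length ∧
      q.last.asIdeal.comap (algebraMap A R) = p.last.asIdeal := by
  induction p using RelSeries.inductionOn' with
  | singleton x =>
    obtain ⟨Q, -, hQ, h⟩ := Ideal.exists_ideal_over_prime_of_isIntegral (S := R) x.asIdeal ⊥ (by
      rw [← RingHom.ker_eq_comap_bot, (RingHom.injective_iff_ker_eq_bot _).1 hinj]; exact bot_le)
    exact ⟨RelSeries.singleton _ ⟨Q, hQ⟩, rfl, h⟩
  | snoc p x hx ih =>
    obtain ⟨q, hl, hq⟩ := ih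
    have hx' : p.last < x := hx
    obtain ⟨Q, hle, hQ, h⟩ := Ideal.exists_ideal_over_prime_of_isIntegral (S := R) x.asIdeal
      q.last.asIdeal (by rw [hq]; exact hx'.le)
    have hlt : q.last < (⟨Q, hQ⟩ : PrimeSpectrum R) := by
      refine lt_of_le_of_ne hle ?_
      intro he
      rw [he] at hq
      apply hx'.ne
      ext1
      rw [← hq, ← h]
    refine ⟨q.snoc ⟨Q, hQ⟩ hlt, ?_, ?_⟩
    · simp [hl]
    · simpa using h

theorem ne_dim_le {A R : Type*} [CommRing A] [CommRing R] [Algebra A R] [Algebra.IsIntegral A R] :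
    ringKrullDim R ≤ ringKrullDim A := by
  refine Order.krullDim_le_of_strictMono (fun J => ⟨J.asIdeal.comap (algebraMap A R), inferInstance⟩) ?_
  intro J K h
  exact Ideal.IsIntegral.comap_lt_comap (R := A) h

theorem ne_dim_ge {A R : Type*} [CommRing A] [CommRing R] [Algebra A R] [Algebra.IsIntegral A R]
    (hinj : Function.Injective (algebraMap A R)) :
    ringKrullDim A ≤ ringKrullDim R := by
  refine iSup_le fun p => ?_
  obtain ⟨q, hq, -⟩ := ne_lift hinj p
  rw [← hq]
  exact le_iSup (fun q : LTSeries (PrimeSpectrum R) => ((q.length : ℕ) : WithBot ℕ∞)) q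

/-- The homogeneous piece of degree `s`. -/
abbrev hp (k : Type*) [Field k] (n s : ℕ) : Submodule k (MvPolynomial (Fin n) k) :=
  homogeneousSubmodule (Fin n) k s

theorem hp_mul (s : ℕ) : hp k n 1 * hp k n s = hp k n (s + 1) := by
  have h := homogeneousSubmodule_one_pow (σ := Fin n) (R := k)
  rw [hp, hp, hp, ← h s, ← h (s + 1), pow_succ', h 1 |>.symm, pow_one]

/-- `V` generates everything in degree `s+1` modulo `I`. -/
def Gd (I : Ideal (MvPolynomial (Fin n) k)) (V : Submodule k (MvPolynomial (Fin n) k)) (s : ℕ) :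
    Prop :=
  hp k n (s + 1) ≤ V * hp k n s ⊔ I.restrictScalars k

theorem mul_rs_le (V : Submodule k (MvPolynomial (Fin n) k)) (I : Ideal (MvPolynomial (Fin n) k)) :
    V * I.restrictScalars k ≤ I.restrictScalars k := by
  rw [Submodule.mul_le]
  intro a _ b hb
  exact I.mul_mem_left a hb

theorem Gd.succ {I : Ideal (MvPolynomial (Fin n) k)} {V : Submodule k (MvPolynomial (Fin n) k)}
    {s : ℕ} (h : Gd I V s) : Gd I V (s + 1) := by
  unfold Gd at *
  rw [← hp_mul (s + 1)]
  refine (mul_le_mul_right h (hp k n 1)).trans ?_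
  rw [Submodule.mul_sup]
  refine sup_le_sup ?_ (mul_rs_le _ _)
  rw [mul_left_comm, hp_mul]

theorem Gd.mono_s {I : Ideal (MvPolynomial (Fin n) k)} {V : Submodule k (MvPolynomial (Fin n) k)}
    {s t : ℕ} (h : Gd I V s) (hst : s ≤ t) : Gd I V t := by
  induction hst with
  | refl => exact h
  | step _ ih => exact ih.succ

/-- Replacing `V` by `W` when `V ≤ W + I`. -/
theorem Gd.of_le {I : Ideal (MvPolynomial (Fin n) k)} {V W : Submodule k (MvPolynomial (Fin n) k)}
    {s : ℕ} (h : Gd I V s) (hVW : V ≤ W ⊔ I.restrictScalars k) : Gd I W s := by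
  unfold Gd at *
  refine h.trans (sup_le ?_ le_sup_right)
  refine (mul_le_mul_left hVW (hp k n s)).trans ?_
  rw [Submodule.sup_mul]
  refine sup_le_sup le_rfl ?_
  rw [mul_comm]
  exact mul_rs_le _ _

theorem maxIdeal_fg : (maxIdeal k n).FG := idealOfVars_fg (Fin n) k

theorem mem_maxIdeal_pow (s : ℕ) (f : MvPolynomial (Fin n) k) :
    f ∈ maxIdeal k n ^ s ↔ ∀ t < s, homogeneousComponent t f = 0 := by
  rw [maxIdeal, mem_pow_idealOfVars_iff']
  constructor
  · intro h t ht
    ext x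
    rw [coeff_homogeneousComponent]
    split_ifs with hx
    · rw [coeff_zero]; exact h x (hx ▸ ht)
    · simp
  · intro h x hx
    have := congrArg (coeff x) (h _ hx)
    rwa [coeff_homogeneousComponent, if_pos rfl, coeff_zero] at this

theorem hp_le_pow (s : ℕ) : hp k n s ≤ (maxIdeal k n ^ s).restrictScalars k := by
  intro f hf
  rw [Submodule.restrictScalars_mem, mem_maxIdeal_pow]
  intro t ht
  rw [homogeneousComponent_of_mem hf, if_neg ht.ne]

theorem maxIdeal_pow_eq (s : ℕ) : maxIdeal k n ^ s = Ideal.span (hp k n s : Set _) := by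
  apply le_antisymm
  · rw [maxIdeal, pow_idealOfVars_eq_span]
    apply Ideal.span_mono
    rintro _ ⟨x, hx, rfl⟩
    exact isHomogeneous_monomial _ hx
  · rw [Ideal.span_le]
    exact hp_le_pow s

/-- Component of a product -/
theorem comp_mul {a b : ℕ} {f g : MvPolynomial (Fin n) k} (hf : f ∈ maxIdeal k n ^ a)
    (hg : g ∈ maxIdeal k n ^ b) :
    homogeneousComponent (a + b) (f * g) =
      homogeneousComponent a f * homogeneousComponent b g := by
  have key : ∀ (s : ℕ) (f : MvPolynomial (Fin n) k), f ∈ maxIdeal k n ^ s →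
      f - homogeneousComponent s f ∈ maxIdeal k n ^ (s + 1) := by
    intro s f hf
    rw [mem_maxIdeal_pow] at hf ⊢
    intro t ht
    rw [map_sub, homogeneousComponent_of_mem (homogeneousComponent_mem s f)]
    split_ifs with h
    · rw [h, sub_self]
    · rw [hf t (by omega), sub_self]
  have h1 := key a f hf
  have h2 := key b g hg
  have e : f * g = homogeneousComponent a f * homogeneousComponent b g +
      (homogeneousComponent a f * (g - homogeneousComponent b g) +
      (f - homogeneousComponent a f) * g) := by ring
  have hz : homogeneousComponent (a + b) (homogeneousComponent a f * (g - homogeneousComponent b g) +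
      (f - homogeneousComponent a f) * g) = 0 := by
    refine (mem_maxIdeal_pow (a + b + 1) _).1 ?_ _ (Nat.lt_succ_self _)
    apply Ideal.add_mem
    · rw [add_assoc, pow_add]
      exact Ideal.mul_mem_mul (hp_le_pow a (homogeneousComponent_mem a f)) h2
    · rw [add_right_comm, pow_add]
      exact Ideal.mul_mem_mul h1 hg
  rw [e, map_add, hz, add_zero, homogeneousComponent_eq_self]
  exact (homogeneousComponent_isHomogeneous a f).mul (homogeneousComponent_isHomogeneous b g)

theorem sub_comp_mem {s : ℕ} {f : MvPolynomial (Fin n) k} (hf : f ∈ maxIdeal k n ^ s) :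
    f - homogeneousComponent s f ∈ maxIdeal k n ^ (s + 1) := by
  rw [mem_maxIdeal_pow] at hf ⊢
  intro t ht
  rw [map_sub, homogeneousComponent_of_mem (homogeneousComponent_mem s f)]
  split_ifs with h
  · rw [h, sub_self]
  · rw [hf t (by omega), sub_self]

/-- linear parts of an ideal -/
def lin (B : Ideal (MvPolynomial (Fin n) k)) : Submodule k (MvPolynomial (Fin n) k) :=
  (B.restrictScalars k).map (homogeneousComponent 1)

theorem lin_le (B : Ideal (MvPolynomial (Fin n) k)) : lin B ≤ hp k n 1 := by
  rintro _ ⟨f, _, rfl⟩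
  exact homogeneousComponent_mem 1 f

theorem gen_mul_pow_le {R : Type*} [CommRing R] {m b : Ideal R} (h : b ≤ m) (s : ℕ) :
    b * m ^ s ≤ m ^ (s + 1) := by
  rw [pow_succ']; exact Ideal.mul_mono_left h

theorem gen_red {R Q : Type*} [CommRing R] [CommRing Q] (f : R →+* Q)
    (hf : Function.Surjective f) (m B : Ideal R) (hB : B.map f ≤ m.map f) (s : ℕ) :
    (m.map f) ^ (s + 1) = B.map f * (m.map f) ^ s ↔
      m ^ (s + 1) ≤ B * m ^ s ⊔ RingHom.ker f := by
  rw [← Ideal.comap_map_of_surjective' f hf,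
    ← Ideal.map_le_iff_le_comap, Ideal.map_mul, Ideal.map_pow, Ideal.map_pow]
  exact ⟨fun h => h.le, fun h => le_antisymm h (gen_mul_pow_le hB s)⟩

/-- the reduction equation lifted to the polynomial ring -/
theorem map_eq_iff (I B : Ideal (MvPolynomial (Fin n) k)) (hB : B ≤ maxIdeal k n ⊔ I) (s : ℕ) :
    maxIdealQ I ^ (s + 1) = (B.map (Ideal.Quotient.mk I)) * maxIdealQ I ^ s ↔
      maxIdeal k n ^ (s + 1) ≤ B * maxIdeal k n ^ s ⊔ I := by
  have hle : B.map (Ideal.Quotient.mk I) ≤ maxIdealQ I := by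
    refine (Ideal.map_mono hB).trans ?_
    rw [Ideal.map_sup, Ideal.map_quotient_self, sup_bot_eq]; rfl
  have := gen_red (Ideal.Quotient.mk I) Ideal.Quotient.mk_surjective (maxIdeal k n) B hle s
  rw [Ideal.mk_ker] at this
  exact this

theorem Gd_of_red {I B : Ideal (MvPolynomial (Fin n) k)} (hI : IsHomog I)
    (hB : B ≤ maxIdeal k n) {s : ℕ}
    (h : maxIdeal k n ^ (s + 1) ≤ B * maxIdeal k n ^ s ⊔ I) : Gd I (lin B) s := by
  intro f hf
  have h1 := h (hp_le_pow _ hf)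
  obtain ⟨g, hg, i, hi, e⟩ := Submodule.mem_sup.1 h1
  have e2 := congrArg (homogeneousComponent (s + 1)) e
  rw [homogeneousComponent_eq_self hf, map_add] at e2
  rw [← e2]
  refine Submodule.add_mem_sup ?_ (hI i hi _)
  clear e e2
  induction hg using Submodule.mul_induction_on' with
  | mem_mul_mem a ha b hb =>
    rw [add_comm, comp_mul (by simpa using hB ha) hb]
    exact Submodule.mul_mem_mul ⟨a, ha, rfl⟩ (homogeneousComponent_mem _ _)
  | add x _ y _ hx hy => rw [map_add]; exact add_mem hx hy

theorem red_of_Gd {I : Ideal (MvPolynomial (Fin n) k)} {V : Submodule k (MvPolynomial (Fin n) k)}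
    {s : ℕ} (h : Gd I V s) :
    maxIdeal k n ^ (s + 1) ≤ Ideal.span (V : Set _) * maxIdeal k n ^ s ⊔ I := by
  rw [maxIdeal_pow_eq (s + 1), Ideal.span_le]
  have : V * hp k n s ⊔ I.restrictScalars k ≤
      (Ideal.span (V : Set _) * maxIdeal k n ^ s ⊔ I).restrictScalars k := by
    refine sup_le ?_ ?_
    · rw [Submodule.mul_le]
      intro a ha b hb
      exact Ideal.mem_sup_left (Ideal.mul_mem_mul (Ideal.subset_span ha) (hp_le_pow _ hb))
    · intro x hx
      exact Ideal.mem_sup_right hx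
  exact h.trans this

/-- iteration -/
theorem iter_le {I B : Ideal (MvPolynomial (Fin n) k)} {s0 : ℕ}
    (h : ∀ s ≥ s0, maxIdeal k n ^ (s + 1) ≤ B * maxIdeal k n ^ s ⊔ maxIdeal k n ^ (s + 2) ⊔ I)
    (j : ℕ) : ∀ s ≥ s0,
    maxIdeal k n ^ (s + 1) ≤ B * maxIdeal k n ^ s ⊔ maxIdeal k n ^ (s + 1 + j) ⊔ I := by
  induction j with
  | zero => intro s _; exact le_sup_of_le_left le_sup_right
  | succ j ih =>
    intro s hs
    refine (ih s hs).trans (sup_le (sup_le (le_sup_of_le_left le_sup_left) ?_) le_sup_right)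
    have := h (s + j) (by omega)
    rw [show s + 1 + j = s + j + 1 by omega]
    refine this.trans (sup_le (sup_le ?_ ?_) le_sup_right)
    · refine le_sup_of_le_left (le_sup_of_le_left (Ideal.mul_mono_right (Ideal.pow_le_pow_right ?_)))
      omega
    · refine le_sup_of_le_left (le_sup_of_le_right (Ideal.pow_le_pow_right ?_))
      omega

theorem comp_mul_lin {x : MvPolynomial (Fin n) k} (hx : x ∈ hp k n 1) (a : MvPolynomial (Fin n) k)
    (s : ℕ) : homogeneousComponent (s + 1) (a * x) = homogeneousComponent s a * x := by
  conv_lhs => rw [← sum_homogeneousComponent a, Finset.sum_mul, map_sum]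
  have : ∀ i, homogeneousComponent (s + 1) (homogeneousComponent i a * x) =
      if i = s then homogeneousComponent s a * x else 0 := by
    intro i
    have h : homogeneousComponent i a * x ∈ homogeneousSubmodule (Fin n) k (i + 1) :=
      (homogeneousComponent_isHomogeneous i a).mul hx
    rw [homogeneousComponent_of_mem h]
    by_cases hi : i = s
    · subst hi; simp
    · rw [if_neg (by omega), if_neg hi]
  simp_rw [this]
  rw [Finset.sum_ite_eq']
  split_ifs with h
  · rfl
  · rw [homogeneousComponent_eq_zero, zero_mul]
    simpa using h

theorem span_homog {I : Ideal (MvPolynomial (Fin n) k)} (hI : IsHomog I)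
    {V : Submodule k (MvPolynomial (Fin n) k)} (hV : V ≤ hp k n 1)
    {f : MvPolynomial (Fin n) k} (hf : f ∈ Ideal.span (V : Set _) ⊔ I) (s : ℕ) :
    homogeneousComponent (s + 1) f ∈ V * hp k n s ⊔ I.restrictScalars k := by
  obtain ⟨g, hg, i, hi, rfl⟩ := Submodule.mem_sup.1 hf
  rw [map_add]
  refine Submodule.add_mem_sup ?_ (hI i hi _)
  clear hf
  suffices h : ∀ a, homogeneousComponent (s + 1) (a * g) ∈ V * hp k n s by simpa using h 1
  induction hg using Submodule.span_induction with
  | mem x hx =>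
    intro a
    rw [comp_mul_lin (hV hx), mul_comm (homogeneousComponent s a) x]
    exact Submodule.mul_mem_mul hx (homogeneousComponent_mem _ _)
  | zero => intro a; rw [mul_zero, map_zero]; exact zero_mem _
  | add x y _ _ hx hy => intro a; rw [mul_add, map_add]; exact add_mem (hx a) (hy a)
  | smul a x hx ih =>
    intro b
    rw [smul_eq_mul, ← mul_assoc]
    exact ih _

/-- From containment of a power of the maximal ideal to degreewise generation. -/
theorem Gd_of_pow {I : Ideal (MvPolynomial (Fin n) k)} (hI : IsHomog I)
    {V : Submodule k (MvPolynomial (Fin n) k)} (hV : V ≤ hp k n 1) {N : ℕ}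
    (h : maxIdeal k n ^ N ≤ Ideal.span (V : Set _) ⊔ I) : Gd I V N := by
  intro f hf
  have := span_homog hI hV (h (Ideal.pow_le_pow_right (Nat.le_succ N) (hp_le_pow _ hf))) N
  rwa [homogeneousComponent_eq_self hf] at this

/-- The quotient is finite over the algebra generated by `V`. -/
theorem finite_of_Gd {I : Ideal (MvPolynomial (Fin n) k)}
    {V : Submodule k (MvPolynomial (Fin n) k)} {s : ℕ} (h : Gd I V s)
    (A : Subalgebra k (MvPolynomial (Fin n) k ⧸ I))
    (hA : ∀ v ∈ V, Ideal.Quotient.mk I v ∈ A) : Module.Finite A (MvPolynomial (Fin n) k ⧸ I) := by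
  classical
  let q : MvPolynomial (Fin n) k →ₗ[k] (MvPolynomial (Fin n) k ⧸ I) :=
    (Ideal.Quotient.mkₐ k I).toLinearMap
  choose G hG using fun t => homogeneousSubmodule_fg (Fin n) k t
  let T : Set (MvPolynomial (Fin n) k ⧸ I) := ⋃ t ∈ Finset.range (s + 1), q '' (G t)
  have hT : T.Finite :=
    Set.Finite.biUnion (Finset.finite_toSet _) fun t _ => Set.Finite.image _ (G t).finite_toSet
  let M : Submodule A (MvPolynomial (Fin n) k ⧸ I) := Submodule.span A T
  have key : ∀ t, hp k n t ≤ (M.restrictScalars k).comap q := by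
    intro t
    induction t with
    | zero =>
      rw [hp, ← hG 0, Submodule.span_le]
      intro g hg
      exact Submodule.subset_span (Set.mem_biUnion (by simp) ⟨g, hg, rfl⟩)
    | succ t ih =>
      by_cases hts : t + 1 ≤ s
      · rw [hp, ← hG (t + 1), Submodule.span_le]
        intro g hg
        exact Submodule.subset_span (Set.mem_biUnion (x := t + 1) (by simpa using hts) ⟨g, hg, rfl⟩)
      · refine (h.mono_s (show s ≤ t by omega)).trans (sup_le ?_ ?_)
        · rw [Submodule.mul_le]
          intro v hv g hg
          have h1 : q (v * g) = (⟨_, hA v hv⟩ : A) • q g := map_mul (Ideal.Quotient.mk I) v g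
          change q (v * g) ∈ M
          rw [h1]
          exact M.smul_mem _ (ih hg)
        · intro f hf
          have h1 : q f = 0 := Ideal.Quotient.eq_zero_iff_mem.2 hf
          change q f ∈ M
          rw [h1]
          exact M.zero_mem
  refine ⟨⟨hT.toFinset, ?_⟩⟩
  rw [Set.Finite.coe_toFinset, eq_top_iff]
  rintro x -
  obtain ⟨f, rfl⟩ := Ideal.Quotient.mk_surjective x
  rw [← sum_homogeneousComponent f, map_sum]
  exact Submodule.sum_mem _ fun t _ => key t (homogeneousComponent_mem t f)

theorem ringKrullDim_mv (e : ℕ) : ringKrullDim (MvPolynomial (Fin e) k) = (e : ℕ∞) := by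
  rw [MvPolynomial.ringKrullDim_of_isNoetherianRing, ringKrullDim_eq_zero_of_field]
  simp

/-- dimension bounds from a generating family of linear forms -/
theorem dim_le_of_Gd {I : Ideal (MvPolynomial (Fin n) k)} {d : ℕ}
    (hd : ringKrullDim (MvPolynomial (Fin n) k ⧸ I) = ((d : ℕ∞) : WithBot ℕ∞))
    {e : ℕ} (y : Fin e → MvPolynomial (Fin n) k) {s : ℕ}
    (h : Gd I (Submodule.span k (Set.range y)) s) :
    d ≤ e ∧ (d < e → ∃ F : MvPolynomial (Fin e) k, F ≠ 0 ∧ aeval y F ∈ I) := by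
  let φ : MvPolynomial (Fin e) k →ₐ[k] (MvPolynomial (Fin n) k ⧸ I) :=
    (Ideal.Quotient.mkₐ k I).comp (aeval y)
  have hfin : Module.Finite φ.range (MvPolynomial (Fin n) k ⧸ I) := by
    refine finite_of_Gd h _ fun v hv => ?_
    have : Submodule.span k (Set.range y) ≤
        (Subalgebra.toSubmodule φ.range).comap (Ideal.Quotient.mkₐ k I).toLinearMap := by
      rw [Submodule.span_le]
      rintro _ ⟨i, rfl⟩
      exact ⟨X i, by simp [φ]⟩
    exact this hv
  have hIntegral : Algebra.IsIntegral φ.range (MvPolynomial (Fin n) k ⧸ I) := inferInstance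
  have h1 : ringKrullDim (MvPolynomial (Fin n) k ⧸ I) ≤ ringKrullDim φ.range := ne_dim_le
  have h2 : ringKrullDim φ.range ≤ ringKrullDim (MvPolynomial (Fin e) k) :=
    ringKrullDim_le_of_surjective φ.rangeRestrict.toRingHom φ.rangeRestrict_surjective
  constructor
  · have := h1.trans h2
    rw [hd, ringKrullDim_mv] at this
    exact_mod_cast this
  · intro hlt
    by_contra! hcon
    have hinj : Function.Injective φ := by
      rw [injective_iff_map_eq_zero]
      intro F hF
      by_contra hne
      exact hcon F hne (Ideal.Quotient.eq_zero_iff_mem.1 hF)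
    have h3 : ringKrullDim φ.range ≤ ringKrullDim (MvPolynomial (Fin n) k ⧸ I) :=
      ne_dim_ge Subtype.val_injective
    have h4 : ringKrullDim (MvPolynomial (Fin e) k) = ringKrullDim φ.range :=
      ringKrullDim_eq_of_ringEquiv (AlgEquiv.ofInjective φ hinj).toRingEquiv
    rw [← h4, ringKrullDim_mv, hd] at h3
    have : e ≤ d := by exact_mod_cast h3
    omega

theorem aeval_scale {R : Type*} [CommRing R] [Algebra k R] {e t : ℕ} {F : MvPolynomial (Fin e) k}
    (hF : F.IsHomogeneous t) (α : Fin e → k) (z : R) :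
    aeval (fun i => algebraMap k R (α i) * z) F = algebraMap k R (eval α F) * z ^ t := by
  rw [aeval_def, eval₂_eq', eval_eq', map_sum, Finset.sum_mul]
  refine Finset.sum_congr rfl fun x hx => ?_
  have hdeg : ∑ i, x i = t := by
    rw [hF.degree_eq_sum_deg_support hx]
    exact (Finset.sum_subset (Finset.subset_univ _) (by simp)).symm
  simp_rw [mul_pow]
  rw [Finset.prod_mul_distrib, Finset.prod_pow_eq_pow_sum, hdeg, map_mul, map_prod]
  simp_rw [map_pow]
  ring

theorem comp_aeval {e : ℕ} {y : Fin e → MvPolynomial (Fin n) k} (hy : ∀ i, y i ∈ hp k n 1)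
    (F : MvPolynomial (Fin e) k) (t : ℕ) :
    homogeneousComponent t (aeval y F) = aeval y (homogeneousComponent t F) := by
  conv_lhs => rw [← sum_homogeneousComponent F, map_sum, map_sum]
  have : ∀ i, homogeneousComponent t (aeval y (homogeneousComponent i F)) =
      if i = t then aeval y (homogeneousComponent t F) else 0 := by
    intro i
    have h : aeval y (homogeneousComponent i F) ∈ homogeneousSubmodule (Fin n) k i := by
      have := (homogeneousComponent_isHomogeneous i F).aeval y (n := 1) hy
      rwa [one_mul] at this
    rw [homogeneousComponent_of_mem h]
    by_cases hi : i = t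
    · subst hi; simp
    · rw [if_neg (by omega), if_neg hi]
  simp_rw [this]
  rw [Finset.sum_ite_eq']
  split_ifs with h
  · rfl
  · rw [homogeneousComponent_eq_zero, map_zero]
    simpa using h

theorem drop_one [Infinite k] {I : Ideal (MvPolynomial (Fin n) k)} (hI : IsHomog I) (hne : I ≠ ⊤)
    {e : ℕ} {y : Fin (e + 1) → MvPolynomial (Fin n) k} (hy : ∀ i, y i ∈ hp k n 1) {s : ℕ}
    (h : Gd I (Submodule.span k (Set.range y)) s) {F : MvPolynomial (Fin (e + 1)) k} (hF : F ≠ 0)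
    (hFI : aeval y F ∈ I) :
    ∃ y' : Fin e → MvPolynomial (Fin n) k, Submodule.span k (Set.range y') ≤
      Submodule.span k (Set.range y) ∧ ∃ s', Gd I (Submodule.span k (Set.range y')) s' := by
  obtain ⟨t, ht⟩ : ∃ t, homogeneousComponent t F ≠ 0 := by
    by_contra! hcon
    apply hF
    rw [← sum_homogeneousComponent F]
    exact Finset.sum_eq_zero fun i _ => hcon i
  have hFt := hI _ hFI t
  rw [comp_aeval hy] at hFt
  have hhom := homogeneousComponent_isHomogeneous t F
  generalize homogeneousComponent t F = P at *
  obtain ⟨α, hα⟩ : ∃ α, eval α P ≠ 0 := by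
    by_contra! hcon
    exact ht (MvPolynomial.funext fun x => by rw [hcon x, map_zero])
  obtain ⟨j, hj⟩ : ∃ j, α j ≠ 0 := by
    by_contra! hcon
    have hz : α = 0 := _root_.funext hcon
    rw [hz] at hα
    rw [eval_zero, constantCoeff_eq] at hα
    have ht0 : t = 0 := by
      by_contra hne
      exact hα (hhom.coeff_eq_zero (by simpa using Ne.symm hne))
    subst ht0
    have hPC : P = C (coeff 0 P) := by
      rw [← homogeneousComponent_zero, homogeneousComponent_eq_self hhom]
    apply hne
    rw [Ideal.eq_top_iff_one]
    rw [hPC, aeval_C] at hFt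
    have := I.mul_mem_left (C (coeff 0 P)⁻¹) hFt
    rw [algebraMap_eq, ← C_mul, inv_mul_cancel₀ hα, C_1] at this
    exact this
  let z : MvPolynomial (Fin n) k := (α j)⁻¹ • y j
  let w : Fin (e + 1) → MvPolynomial (Fin n) k := fun i => y i - α i • z
  let y' : Fin e → MvPolynomial (Fin n) k := fun i => w (j.succAbove i)
  have hwj : w j = 0 := by simp [w, z, smul_smul, mul_inv_cancel₀ hj]
  have hzV : z ∈ Submodule.span k (Set.range y) :=
    Submodule.smul_mem _ _ (Submodule.subset_span ⟨j, rfl⟩)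
  have hwV : ∀ i, w i ∈ Submodule.span k (Set.range y) := fun i =>
    Submodule.sub_mem _ (Submodule.subset_span ⟨i, rfl⟩) (Submodule.smul_mem _ _ hzV)
  have hle : Submodule.span k (Set.range y') ≤ Submodule.span k (Set.range y) := by
    rw [Submodule.span_le]
    rintro _ ⟨i, rfl⟩
    exact hwV _
  have hV1 : Submodule.span k (Set.range y) ≤ hp k n 1 := by
    rw [Submodule.span_le]
    rintro _ ⟨i, rfl⟩
    exact hy i
  have hwW : ∀ i, w i ∈ Submodule.span k (Set.range y') := by
    intro i
    by_cases hij : i = j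
    · rw [hij, hwj]; exact zero_mem _
    · obtain ⟨l, rfl⟩ := Fin.exists_succAbove_eq hij
      exact Submodule.subset_span ⟨l, rfl⟩
  refine ⟨y', hle, ?_⟩
  set W := Submodule.span k (Set.range y') with hW
  set J := Ideal.span (W : Set (MvPolynomial (Fin n) k)) ⊔ I with hJ
  have hwJ : ∀ i, w i ∈ J := fun i => Ideal.mem_sup_left (Ideal.subset_span (hwW i))
  have hzJ : z ^ t ∈ J := by
    rw [← Ideal.Quotient.eq_zero_iff_mem]
    have e1 : ∀ i, Ideal.Quotient.mk J (y i) =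
        algebraMap k _ (α i) * Ideal.Quotient.mk J z := by
      intro i
      have : Ideal.Quotient.mk J (y i) = Ideal.Quotient.mk J (α i • z) :=
        Ideal.Quotient.eq.2 (hwJ i)
      rw [this, smul_eq_C_mul, map_mul]
      rfl
    have e2 : Ideal.Quotient.mk J (aeval y P) = 0 :=
      Ideal.Quotient.eq_zero_iff_mem.2 (Ideal.mem_sup_right hFt)
    have e3 : Ideal.Quotient.mkₐ k J (aeval y P) =
        aeval (fun i => Ideal.Quotient.mk J (y i)) P :=
      MvPolynomial.comp_aeval_apply y (Ideal.Quotient.mkₐ k J) P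
    replace e2 := e3.symm.trans e2
    simp_rw [e1] at e2
    rw [aeval_scale hhom] at e2
    have e4 := congrArg (fun x => algebraMap k (MvPolynomial (Fin n) k ⧸ J) (eval α P)⁻¹ * x) e2
    simp only [mul_zero] at e4
    rw [← mul_assoc, ← map_mul, inv_mul_cancel₀ hα, map_one, one_mul] at e4
    rw [map_pow, e4]
  have hzr : z ∈ J.radical := ⟨t, hzJ⟩
  have hyr : ∀ i, y i ∈ J.radical := by
    intro i
    have : y i = w i + C (α i) * z := by simp [w, smul_eq_C_mul]
    rw [this]
    exact add_mem (Ideal.le_radical (hwJ i)) (J.radical.mul_mem_left _ hzr)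
  have hVr : Ideal.span ((Submodule.span k (Set.range y) : Submodule k _) :
      Set (MvPolynomial (Fin n) k)) ≤ J.radical := by
    rw [Ideal.span_le]
    have : Submodule.span k (Set.range y) ≤ J.radical.restrictScalars k := by
      rw [Submodule.span_le]
      rintro _ ⟨i, rfl⟩
      exact hyr i
    exact this
  have hM : maxIdeal k n ^ (s + 1) ≤ J.radical :=
    (red_of_Gd h).trans (sup_le (Ideal.mul_le_left.trans hVr)
      (le_sup_right.trans Ideal.le_radical))
  have hM1 : maxIdeal k n ≤ J.radical := by
    intro x hx
    have := hM (Ideal.pow_mem_pow hx (s + 1))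
    rw [← Ideal.radical_idem]
    exact ⟨_, this⟩
  obtain ⟨N, hN⟩ := Ideal.exists_pow_le_of_le_radical_of_fg hM1 maxIdeal_fg
  exact ⟨N, Gd_of_pow hI (hle.trans hV1) hN⟩

theorem noether [Infinite k] {I : Ideal (MvPolynomial (Fin n) k)} (hI : IsHomog I) {d : ℕ}
    (hd : ringKrullDim (MvPolynomial (Fin n) k ⧸ I) = ((d : ℕ∞) : WithBot ℕ∞)) (e : ℕ) :
    ∀ (y : Fin e → MvPolynomial (Fin n) k), (∀ i, y i ∈ hp k n 1) → ∀ s,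
      Gd I (Submodule.span k (Set.range y)) s →
    ∃ y' : Fin d → MvPolynomial (Fin n) k, Submodule.span k (Set.range y') ≤
      Submodule.span k (Set.range y) ∧ ∃ s', Gd I (Submodule.span k (Set.range y')) s' := by
  have hne : I ≠ ⊤ := by
    rintro rfl
    rw [ringKrullDim_eq_bot_of_subsingleton] at hd
    exact absurd hd (by simp)
  induction e with
  | zero =>
    intro y hy s h
    have h1 := (dim_le_of_Gd hd y h).1
    obtain rfl : d = 0 := by omega
    exact ⟨y, le_rfl, s, h⟩
  | succ e ih =>
    intro y hy s h
    obtain ⟨h1, h2⟩ := dim_le_of_Gd hd y h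
    rcases h1.eq_or_lt with rfl | hlt
    · exact ⟨y, le_rfl, s, h⟩
    · obtain ⟨F, hF, hFI⟩ := h2 hlt
      obtain ⟨y1, hle, s1, h3⟩ := drop_one hI hne hy h hF hFI
      have hy1 : ∀ i, y1 i ∈ hp k n 1 := by
        intro i
        have : Submodule.span k (Set.range y) ≤ hp k n 1 := by
          rw [Submodule.span_le]
          rintro _ ⟨i, rfl⟩
          exact hy i
        exact this (hle (Submodule.subset_span ⟨i, rfl⟩))
      obtain ⟨y2, hle2, h4⟩ := ih y1 hy1 s1 h3
      exact ⟨y2, hle2.trans hle, h4⟩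

theorem noether' [Infinite k] {I : Ideal (MvPolynomial (Fin n) k)} (hI : IsHomog I) {d : ℕ}
    (hd : ringKrullDim (MvPolynomial (Fin n) k ⧸ I) = ((d : ℕ∞) : WithBot ℕ∞))
    {V : Submodule k (MvPolynomial (Fin n) k)} (hV : V ≤ hp k n 1) {s : ℕ} (h : Gd I V s) :
    ∃ y' : Fin d → MvPolynomial (Fin n) k, Submodule.span k (Set.range y') ≤ V ∧
      ∃ s', Gd I (Submodule.span k (Set.range y')) s' := by
  have hVfg : V.FG := (homogeneousSubmodule_fg (Fin n) k 1).of_le hV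
  obtain ⟨e, y, hy⟩ := Submodule.fg_iff_exists_fin_generating_family.1 hVfg
  rw [← hy] at h ⊢
  refine noether hI hd e y (fun i => hV ?_) s h
  rw [← hy]
  exact Submodule.subset_span ⟨i, rfl⟩

/-- lower bound on the dimension of a generating space -/
theorem le_finrank [Infinite k] {I : Ideal (MvPolynomial (Fin n) k)} {d : ℕ}
    (hd : ringKrullDim (MvPolynomial (Fin n) k ⧸ I) = ((d : ℕ∞) : WithBot ℕ∞))
    {V : Submodule k (MvPolynomial (Fin n) k)} (hV : V.FG) {s : ℕ} (h : Gd I V s) :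
    d ≤ Module.finrank k V := by
  have : Module.Finite k V := Module.Finite.iff_fg.2 hV
  let b := Module.finBasis k V
  refine (dim_le_of_Gd hd (fun i => (b i : MvPolynomial (Fin n) k)) (s := s) ?_).1
  have : Submodule.span k (Set.range fun i => (b i : MvPolynomial (Fin n) k)) = V := by
    have := congrArg (Submodule.map V.subtype) b.span_eq
    rw [Submodule.map_span, ← Set.range_comp] at this
    simpa [Function.comp_def] using this
  rwa [this]

theorem le_maxIdeal {I : Ideal (MvPolynomial (Fin n) k)} (hI : IsHomog I) (hne : I ≠ ⊤) :
    I ≤ maxIdeal k n := by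
  intro f hf
  rw [← pow_one (maxIdeal k n), mem_maxIdeal_pow]
  intro t ht
  obtain rfl : t = 0 := by omega
  have h := hI f hf 0
  rw [homogeneousComponent_zero] at h ⊢
  by_contra hc
  apply hne
  refine Ideal.eq_top_of_isUnit_mem _ h ?_
  have hc' : coeff 0 f ≠ 0 := fun h0 => hc (by rw [h0, C_0])
  exact (isUnit_iff_ne_zero.2 hc').map C

theorem lin_mem {x : MvPolynomial (Fin n) k} (hx : x ∈ hp k n 1) : x ∈ maxIdeal k n := by
  simpa using hp_le_pow 1 hx

theorem span_le_maxIdeal {V : Submodule k (MvPolynomial (Fin n) k)} (hV : V ≤ hp k n 1) :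
    Ideal.span (V : Set _) ≤ maxIdeal k n := by
  rw [Ideal.span_le]
  exact fun x hx => lin_mem (hV hx)

theorem map_mk_le_iff {I A B : Ideal (MvPolynomial (Fin n) k)} :
    A.map (Ideal.Quotient.mk I) ≤ B.map (Ideal.Quotient.mk I) ↔ A ≤ B ⊔ I := by
  rw [Ideal.map_le_iff_le_comap, Ideal.comap_map_of_surjective' _ Ideal.Quotient.mk_surjective,
    Ideal.mk_ker]

theorem le_comap_mk {I : Ideal (MvPolynomial (Fin n) k)} (b : Ideal (MvPolynomial (Fin n) k ⧸ I)) :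
    I ≤ b.comap (Ideal.Quotient.mk I) := by
  intro x hx
  rw [Ideal.mem_comap, Ideal.Quotient.eq_zero_iff_mem.2 hx]
  exact b.zero_mem

/-- Lift a reduction to the polynomial ring. -/
theorem exists_lift {I : Ideal (MvPolynomial (Fin n) k)} (hI : IsHomog I) (hne : I ≠ ⊤)
    {b : Ideal (MvPolynomial (Fin n) k ⧸ I)} (hb : b ≤ maxIdealQ I) :
    ∃ B : Ideal (MvPolynomial (Fin n) k), I ≤ B ∧ B ≤ maxIdeal k n ∧
      B.map (Ideal.Quotient.mk I) = b := by
  have e := Ideal.map_comap_of_surjective _ (Ideal.Quotient.mk_surjective (I := I)) b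
  refine ⟨_, le_comap_mk b, ?_, e⟩
  rw [← e, maxIdealQ, map_mk_le_iff, sup_eq_left.2 (le_maxIdeal hI hne)] at hb
  exact hb

theorem span_decomp {V : Submodule k (MvPolynomial (Fin n) k)} :
    (Ideal.span (V : Set _)).restrictScalars k ≤
      V ⊔ (maxIdeal k n * Ideal.span (V : Set _)).restrictScalars k := by
  intro x hx
  change x ∈ Ideal.span (V : Set _) at hx
  induction hx using Submodule.span_induction with
  | mem x hx => exact Submodule.mem_sup_left hx
  | zero => exact zero_mem _
  | add x y _ _ hx hy => exact add_mem hx hy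
  | smul a x hx ih =>
    have ha : a - C (coeff 0 a) ∈ maxIdeal k n := by
      have := sub_comp_mem (s := 0) (f := a) (by simp)
      rwa [homogeneousComponent_zero, zero_add, pow_one] at this
    have e : a • x = (a - C (coeff 0 a)) * x + (coeff 0 a) • x := by
      rw [smul_eq_C_mul, smul_eq_mul]; ring
    rw [e]
    exact add_mem (Submodule.mem_sup_right (Ideal.mul_mem_mul ha hx)) (Submodule.smul_mem _ _ ih)

theorem isReduction_of_Gd {I : Ideal (MvPolynomial (Fin n) k)}
    {V : Submodule k (MvPolynomial (Fin n) k)} (hV : V ≤ hp k n 1) {s : ℕ} (h : Gd I V s) :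
    IsReduction (maxIdealQ I) ((Ideal.span (V : Set _)).map (Ideal.Quotient.mk I)) ∧
    ∀ r ≥ s, maxIdealQ I ^ (r + 1) =
      (Ideal.span (V : Set _)).map (Ideal.Quotient.mk I) * maxIdealQ I ^ r := by
  have h1 : ∀ r ≥ s, maxIdealQ I ^ (r + 1) =
      (Ideal.span (V : Set _)).map (Ideal.Quotient.mk I) * maxIdealQ I ^ r := by
    intro r hr
    exact (map_eq_iff I _ ((span_le_maxIdeal hV).trans le_sup_left) r).2 (red_of_Gd (h.mono_s hr))
  exact ⟨⟨Ideal.map_mono (span_le_maxIdeal hV), s, h1⟩, h1⟩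

theorem minimal_of_Gd [Infinite k] {I : Ideal (MvPolynomial (Fin n) k)} (hI : IsHomog I) {d : ℕ}
    (hd : ringKrullDim (MvPolynomial (Fin n) k ⧸ I) = ((d : ℕ∞) : WithBot ℕ∞)) (hne : I ≠ ⊤)
    {V : Submodule k (MvPolynomial (Fin n) k)} (hV : V ≤ hp k n 1)
    (hfr : Module.finrank k V ≤ d) {s : ℕ} (h : Gd I V s) :
    IsMinimalReduction (maxIdealQ I) ((Ideal.span (V : Set _)).map (Ideal.Quotient.mk I)) := by
  refine ⟨(isReduction_of_Gd hV h).1, ?_⟩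
  rintro b ⟨hbm, N, hN⟩ hba
  obtain ⟨B, hIB, hBM, rfl⟩ := exists_lift hI hne hbm
  refine le_antisymm hba ?_
  have h1 := (map_eq_iff I B (hBM.trans le_sup_left) N).1 (hN N le_rfl)
  have hMB : maxIdeal k n ^ (N + 1) ≤ B := h1.trans (sup_le Ideal.mul_le_left hIB)
  have hBV : B ≤ Ideal.span (V : Set _) ⊔ I := map_mk_le_iff.1 hba
  have hG := Gd_of_red hI hBM h1
  have hVfg : V.FG := (homogeneousSubmodule_fg (Fin n) k 1).of_le hV
  have hVB : V ≤ lin B := by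
    have h2 : lin B ≤ (V ⊓ lin B) ⊔ I.restrictScalars k := by
      rintro x hx
      have hx' := hx
      obtain ⟨g, hg, rfl⟩ := hx
      have h3 := span_homog hI hV (hBV hg) 0
      have h0 : hp k n 0 = 1 := homogeneousSubmodule_zero (Fin n)
      rw [h0, mul_one, zero_add] at h3
      obtain ⟨v, hv, i, hi, e⟩ := Submodule.mem_sup.1 h3
      rw [← e]
      refine Submodule.add_mem_sup ⟨hv, ?_⟩ hi
      have hi1 : i ∈ hp k n 1 := by
        rw [← add_sub_cancel_left v i, e]
        exact sub_mem (homogeneousComponent_mem _ _) (hV hv)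
      have hil : i ∈ lin B := ⟨i, hIB hi, homogeneousComponent_eq_self hi1⟩
      rw [← add_sub_cancel_right v i, e]
      exact sub_mem hx' hil
    have h3 := le_finrank hd (hVfg.of_le inf_le_left) (hG.of_le h2)
    have : Module.Finite k V := Module.Finite.iff_fg.2 hVfg
    have h4 : V ⊓ lin B = V := Submodule.eq_of_le_of_finrank_le inf_le_left (hfr.trans h3)
    rw [← h4]
    exact inf_le_right
  have hstep : Ideal.span (V : Set _) ≤ B ⊔ maxIdeal k n * Ideal.span (V : Set _) := by
    rw [Ideal.span_le]
    intro v hv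
    obtain ⟨g, hg, rfl⟩ := hVB hv
    obtain ⟨u, hu, i, hi, e⟩ := Submodule.mem_sup.1 (hBV hg)
    obtain ⟨u1, hu1, w, hw, e2⟩ := Submodule.mem_sup.1 (span_decomp hu)
    have hw1 : homogeneousComponent 1 w = 0 := by
      refine (mem_maxIdeal_pow 2 w).1 ?_ 1 (by omega)
      rw [pow_two]
      exact Ideal.mul_mono_right (span_le_maxIdeal hV) hw
    have e3 : homogeneousComponent 1 g = u1 + homogeneousComponent 1 i := by
      rw [← e, ← e2, map_add, map_add, hw1, add_zero, homogeneousComponent_eq_self (hV hu1)]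
    have e4 : homogeneousComponent 1 g = (g - i + homogeneousComponent 1 i) + (-w) := by
      rw [e3, ← e, ← e2]; ring
    rw [e4]
    exact Submodule.add_mem_sup (add_mem (sub_mem hg (hIB hi)) (hIB (hI i hi 1))) (neg_mem hw)
  have hiter : ∀ j : ℕ, Ideal.span (V : Set _) ≤
      B ⊔ maxIdeal k n ^ j * Ideal.span (V : Set _) := by
    intro j
    induction j with
    | zero => simp
    | succ j ih =>
      refine hstep.trans (sup_le le_sup_left ((Ideal.mul_mono_right ih).trans ?_))
      rw [Ideal.mul_sup, ← mul_assoc, ← pow_succ']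
      exact sup_le_sup Ideal.mul_le_right le_rfl
  exact Ideal.map_mono ((hiter (N + 1)).trans (sup_le le_rfl (Ideal.mul_le_left.trans hMB)))

theorem structure_of_minimal [Infinite k] {I : Ideal (MvPolynomial (Fin n) k)} (hI : IsHomog I)
    {d : ℕ} (hd : ringKrullDim (MvPolynomial (Fin n) k ⧸ I) = ((d : ℕ∞) : WithBot ℕ∞))
    (hne : I ≠ ⊤) {a : Ideal (MvPolynomial (Fin n) k ⧸ I)}
    (ha : IsMinimalReduction (maxIdealQ I) a) {r : ℕ}
    (hr : maxIdealQ I ^ (r + 1) = a * maxIdealQ I ^ r) :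
    ∃ y : Fin d → MvPolynomial (Fin n) k, (∀ i, y i ∈ hp k n 1) ∧
      Gd I (Submodule.span k (Set.range y)) r := by
  obtain ⟨⟨ham, N, hN⟩, hmin⟩ := ha
  obtain ⟨A, hIA, hAM, rfl⟩ := exists_lift hI hne ham
  have h1 := (map_eq_iff I A (hAM.trans le_sup_left) N).1 (hN N le_rfl)
  have hMA : maxIdeal k n ^ (N + 1) ≤ A := h1.trans (sup_le Ideal.mul_le_left hIA)
  have hG := Gd_of_red hI hAM ((map_eq_iff I A (hAM.trans le_sup_left) r).1 hr)
  obtain ⟨y, hy, s0, hs0⟩ := noether' hI hd (lin_le A) hG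
  refine ⟨y, fun i => lin_le A (hy (Submodule.subset_span ⟨i, rfl⟩)), ?_⟩
  set W := Submodule.span k (Set.range y) with hW
  let B : Ideal (MvPolynomial (Fin n) k) :=
    { carrier := {g | g ∈ A ∧ homogeneousComponent 1 g ∈ W ⊔ I.restrictScalars k}
      zero_mem' := ⟨A.zero_mem, by rw [map_zero]; exact zero_mem _⟩
      add_mem' := fun {x z} hx hz => ⟨A.add_mem hx.1 hz.1, by
        rw [map_add]; exact add_mem hx.2 hz.2⟩
      smul_mem' := fun c x hx => ⟨A.mul_mem_left c hx.1, by
        have := comp_mul (a := 0) (b := 1) (f := c) (g := x) (by simp) (by simpa using hAM hx.1)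
        rw [zero_add] at this
        rw [smul_eq_mul, this, homogeneousComponent_zero, ← smul_eq_C_mul]
        exact Submodule.smul_mem _ _ hx.2⟩ }
  have hBA : B ≤ A := fun x hx => hx.1
  have hIB : I ≤ B := fun x hx => ⟨hIA hx, Submodule.mem_sup_right (hI x hx 1)⟩
  have hMB : maxIdeal k n ^ (N + 2) ≤ B := by
    intro x hx
    refine ⟨hMA (Ideal.pow_le_pow_right (by omega) hx), ?_⟩
    rw [(mem_maxIdeal_pow _ x).1 hx 1 (by omega)]
    exact zero_mem _
  have hWB : Ideal.span (W : Set _) ≤ B ⊔ maxIdeal k n ^ 2 := by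
    rw [Ideal.span_le]
    intro w hw
    obtain ⟨g, hg, rfl⟩ := hy hw
    have e : homogeneousComponent 1 g = g + -(g - homogeneousComponent 1 g) := by ring
    rw [e]
    refine Submodule.add_mem_sup ⟨hg, Submodule.mem_sup_left hw⟩ (neg_mem ?_)
    exact sub_comp_mem (by simpa using hAM hg)
  have hstep : ∀ s ≥ s0, maxIdeal k n ^ (s + 1) ≤
      B * maxIdeal k n ^ s ⊔ maxIdeal k n ^ (s + 2) ⊔ I := by
    intro s hs
    refine (red_of_Gd (hs0.mono_s hs)).trans (sup_le_sup ?_ le_rfl)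
    refine (Ideal.mul_mono_left hWB).trans ?_
    rw [Ideal.sup_mul, ← pow_add, add_comm 2 s]
  have hred : IsReduction (maxIdealQ I) (B.map (Ideal.Quotient.mk I)) := by
    refine ⟨(Ideal.map_mono (hBA.trans hAM)), s0, fun s hs => ?_⟩
    refine (map_eq_iff I B ((hBA.trans hAM).trans le_sup_left) s).2 ?_
    refine (iter_le hstep (N + 2) s hs).trans (sup_le (sup_le le_sup_left ?_) le_sup_right)
    refine le_sup_of_le_left ?_
    refine (Ideal.pow_le_pow_right (show N + 2 + s ≤ _ by omega)).trans ?_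
    rw [pow_add]
    exact Ideal.mul_mono_left hMB
  have heq := hmin _ hred (Ideal.map_mono hBA)
  have hAB : A ≤ B := by
    have := map_mk_le_iff.1 heq.ge
    rwa [sup_eq_left.2 hIB] at this
  refine hG.of_le ?_
  rintro _ ⟨g, hg, rfl⟩
  exact (hAB hg).2

/-- The linear forms attached to a coefficient tuple. -/
def lf {d : ℕ} (c : Fin d → Fin n → k) (i : Fin d) : MvPolynomial (Fin n) k :=
  ∑ j, C (c i j) * X j

theorem lf_mem {d : ℕ} (c : Fin d → Fin n → k) (i : Fin d) : lf c i ∈ hp k n 1 := by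
  refine Submodule.sum_mem _ fun j _ => ?_
  exact isHomogeneous_C_mul_X _ _

theorem mem_span_mul {d : ℕ} (y : Fin d → MvPolynomial (Fin n) k)
    (H : Submodule k (MvPolynomial (Fin n) k)) {f : MvPolynomial (Fin n) k}
    (hf : f ∈ Submodule.span k (Set.range y) * H) :
    ∃ h : Fin d → MvPolynomial (Fin n) k, (∀ i, h i ∈ H) ∧ f = ∑ i, y i * h i := by
  induction hf using Submodule.mul_induction_on' with
  | mem_mul_mem v hv g hg =>
    obtain ⟨c, rfl⟩ := (Submodule.mem_span_range_iff_exists_fun k).1 hv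
    refine ⟨fun i => c i • g, fun i => H.smul_mem _ hg, ?_⟩
    rw [Finset.sum_mul]
    exact Finset.sum_congr rfl fun i _ => by rw [smul_mul_assoc, mul_smul_comm]
  | add x _ z _ hx hz =>
    obtain ⟨h1, h1m, rfl⟩ := hx
    obtain ⟨h2, h2m, rfl⟩ := hz
    exact ⟨fun i => h1 i + h2 i, fun i => add_mem (h1m i) (h2m i), by
      simp_rw [mul_add, Finset.sum_add_distrib]⟩

theorem open_Gd {I : Ideal (MvPolynomial (Fin n) k)} {d r : ℕ} (c0 : Fin d → Fin n → k)
    (h : Gd I (Submodule.span k (Set.range (lf c0))) r) :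
    ∃ p : MvPolynomial (Fin d × Fin n) k, eval (fun q => c0 q.1 q.2) p ≠ 0 ∧
      ∀ c : Fin d → Fin n → k, eval (fun q => c q.1 q.2) p ≠ 0 →
        Gd I (Submodule.span k (Set.range (lf c))) r := by
  classical
  let q : MvPolynomial (Fin n) k →ₗ[k] (MvPolynomial (Fin n) k ⧸ I) :=
    (Ideal.Quotient.mkₐ k I).toLinearMap
  have hq : ∀ f, q f = 0 ↔ f ∈ I := fun f => Ideal.Quotient.eq_zero_iff_mem
  let E : Submodule k (MvPolynomial (Fin n) k ⧸ I) := (hp k n (r + 1)).map q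
  have : Module.Finite k E :=
    Module.Finite.iff_fg.2 ((homogeneousSubmodule_fg (Fin n) k (r + 1)).map q)
  let b := Module.finBasis k E
  have hb : ∀ l, ∃ g : Fin d → MvPolynomial (Fin n) k, (∀ i, g i ∈ hp k n r) ∧
      q (∑ i, lf c0 i * g i) = b l := by
    intro l
    obtain ⟨f, hf, hfl⟩ := (b l).2
    obtain ⟨f1, hf1, i, hi, e⟩ := Submodule.mem_sup.1 (h hf)
    obtain ⟨g, hg, rfl⟩ := mem_span_mul _ _ hf1
    refine ⟨g, hg, ?_⟩
    rw [← hfl, ← e, map_add, (hq i).2 hi, add_zero]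
  choose g hg hgb using hb
  let ε : Fin d → Fin n → Fin (Module.finrank k E) → E := fun i j l =>
    ⟨q (X j * g l i), X j * g l i, by
      rw [add_comm]
      exact (isHomogeneous_X k j).mul (hg l i), rfl⟩
  let u : (Fin d → Fin n → k) → Fin (Module.finrank k E) → E := fun c l =>
    ∑ i, ∑ j, c i j • ε i j l
  have hu : ∀ c l, (u c l : MvPolynomial (Fin n) k ⧸ I) = q (∑ i, lf c i * g l i) := by
    intro c l
    simp only [u, ε, lf, Submodule.coe_sum, Submodule.coe_smul, map_sum, Finset.sum_mul]
    refine Finset.sum_congr rfl fun i _ => Finset.sum_congr rfl fun j _ => ?_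
    rw [← map_smul, mul_assoc, smul_eq_C_mul]
  let PM : Matrix (Fin (Module.finrank k E)) (Fin (Module.finrank k E))
      (MvPolynomial (Fin d × Fin n) k) := fun l' l =>
    ∑ i, ∑ j, X (i, j) * C (b.repr (ε i j l) l')
  have hdet : ∀ c : Fin d → Fin n → k, eval (fun q => c q.1 q.2) PM.det = b.det (u c) := by
    intro c
    rw [Module.Basis.det_apply, RingHom.map_det]
    congr 1
    ext l' l
    rw [RingHom.mapMatrix_apply, Matrix.map_apply]
    simp [PM, u, Module.Basis.toMatrix_apply, Finsupp.finsetSum_apply]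
  refine ⟨PM.det, ?_, ?_⟩
  · rw [hdet]
    have : u c0 = b := by
      funext l
      apply Subtype.ext
      rw [hu, hgb]
    rw [this, Module.Basis.det_self]
    exact one_ne_zero
  · intro c hc
    rw [hdet] at hc
    have hspan := (Module.Basis.is_basis_iff_det b).2 (isUnit_iff_ne_zero.2 hc) |>.2
    have hle : Submodule.span k (Set.range (u c)) ≤
        ((Submodule.span k (Set.range (lf c)) * hp k n r).map q).comap E.subtype := by
      rw [Submodule.span_le]
      rintro _ ⟨l, rfl⟩
      refine ⟨∑ i, lf c i * g l i, ?_, (hu c l).symm⟩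
      exact Submodule.sum_mem _ fun i _ =>
        Submodule.mul_mem_mul (Submodule.subset_span ⟨i, rfl⟩) (hg l i)
    rw [hspan] at hle
    intro f hf
    obtain ⟨f1, hf1, e⟩ := hle (x := ⟨q f, f, hf, rfl⟩) Submodule.mem_top
    have e' : q f1 = q f := e
    rw [← add_sub_cancel f1 f]
    refine Submodule.add_mem_sup hf1 ?_
    change f - f1 ∈ I
    rw [← hq, map_sub, e', sub_self]

/-- Lemma 4.2: over an infinite field, there is a nonempty Zariski-open set of
coefficient tuples `c ∈ (kⁿ)^d` such that for the corresponding linear forms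
`yᵢ = ∑ⱼ cᵢⱼ xⱼ`, the ideal `𝔞 = (I, y₁, …, y_d)/I` is a minimal reduction of the
maximal graded ideal `𝔪` of `S/I` with `r_𝔞(S/I) = r(S/I)`. -/
theorem statement15 {k : Type*} [Field k] [Infinite k] {n : ℕ}
    (I : Ideal (MvPolynomial (Fin n) k)) (hI : IsHomog I) (d : ℕ)
    (hd : ringKrullDim (MvPolynomial (Fin n) k ⧸ I) = ((d : ℕ∞) : WithBot ℕ∞)) :
    ∃ U : Set (Fin d → Fin n → k), U.Nonempty ∧
      (∃ P : Set (MvPolynomial (Fin d × Fin n) k),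
        U = {c | ∃ p ∈ P, MvPolynomial.eval (fun q => c q.1 q.2) p ≠ 0}) ∧
      ∀ c ∈ U,
        IsMinimalReduction (maxIdealQ I)
          (Ideal.map (Ideal.Quotient.mk I)
            (Ideal.span (Set.range fun i : Fin d => ∑ j, C (c i j) * X j))) ∧
        redNum (maxIdealQ I)
          (Ideal.map (Ideal.Quotient.mk I)
            (Ideal.span (Set.range fun i : Fin d => ∑ j, C (c i j) * X j))) =
          ringRedNum (maxIdealQ I) := by
  have hne : I ≠ ⊤ := by
    rintro rfl
    rw [ringKrullDim_eq_bot_of_subsingleton] at hd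
    exact absurd hd (by simp)
  have hspan1 : ∀ y : Fin d → MvPolynomial (Fin n) k, (∀ i, y i ∈ hp k n 1) →
      Submodule.span k (Set.range y) ≤ hp k n 1 := by
    intro y hy
    rw [Submodule.span_le]
    rintro _ ⟨i, rfl⟩
    exact hy i
  have hfr : ∀ y : Fin d → MvPolynomial (Fin n) k,
      Module.finrank k (Submodule.span k (Set.range y)) ≤ d := by
    intro y
    have := finrank_range_le_card (R := k) y
    rwa [Fintype.card_fin] at this
  have hnonempty : {r | ∃ a, IsMinimalReduction (maxIdealQ I) a ∧
      redNum (maxIdealQ I) a = r}.Nonempty := by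
    have h0 : Gd I (hp k n 1) 0 := by
      unfold Gd
      rw [hp_mul]
      exact le_sup_left
    obtain ⟨y, hy, s, hs⟩ := noether' hI hd le_rfl h0
    exact ⟨_, _, minimal_of_Gd hI hd hne hy (hfr y) hs, rfl⟩
  obtain ⟨a, ha, har⟩ := Nat.sInf_mem hnonempty
  have hared : maxIdealQ I ^ (ringRedNum (maxIdealQ I) + 1) =
      a * maxIdealQ I ^ (ringRedNum (maxIdealQ I)) := by
    obtain ⟨N, hN⟩ := ha.1.2
    have h1 : {r | maxIdealQ I ^ (r + 1) = a * maxIdealQ I ^ r}.Nonempty := ⟨N, hN N le_rfl⟩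
    have h2 := Nat.sInf_mem h1
    have h3 : sInf {r | maxIdealQ I ^ (r + 1) = a * maxIdealQ I ^ r} =
      ringRedNum (maxIdealQ I) := har
    rw [h3] at h2
    exact h2
  obtain ⟨y, hy, hG⟩ := structure_of_minimal hI hd hne ha hared
  have hc : ∀ i, ∃ c : Fin n → k, y i = ∑ j, C (c j) * X j := by
    intro i
    have := hy i
    rw [hp, homogeneousSubmodule_one_eq_span_X] at this
    obtain ⟨c, e⟩ := (Submodule.mem_span_range_iff_exists_fun k).1 this
    exact ⟨c, by rw [← e]; exact Finset.sum_congr rfl fun j _ => smul_eq_C_mul _ _⟩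
  choose c0 hc0 using hc
  have hy0 : y = lf c0 := _root_.funext hc0
  rw [hy0] at hG
  obtain ⟨p, hp0, hp⟩ := open_Gd c0 hG
  refine ⟨{c | ∃ q ∈ ({p} : Set _), MvPolynomial.eval (fun q => c q.1 q.2) q ≠ 0},
    ⟨c0, p, rfl, hp0⟩, ⟨{p}, rfl⟩, ?_⟩
  rintro c ⟨q, rfl, hcq⟩
  have hGc := hp c hcq
  have hV1 := hspan1 (lf c) (lf_mem c)
  have e : Ideal.span (Set.range fun i : Fin d => ∑ j, C (c i j) * X j) =
      Ideal.span ((Submodule.span k (Set.range (lf c)) : Submodule k _) :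
        Set (MvPolynomial (Fin n) k)) := (Submodule.span_span_of_tower k _ _).symm
  rw [e]
  have hm := minimal_of_Gd hI hd hne hV1 (hfr _) hGc
  refine ⟨hm, le_antisymm ?_ ?_⟩
  · exact Nat.sInf_le ((isReduction_of_Gd hV1 hGc).2 _ le_rfl)
  · exact Nat.sInf_le ⟨_, hm, rfl⟩
end
end Paper
end
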